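/- arXiv:1510.01349 — 2 statements merged into one kernel-verified Lean document; each statement's English description precedes it below -/
import Mathlib

section
/- Let n and m be positive integers, let c be a vector of n polynomials with integer coefficients in one variable u, let A be an m × n matrix of such polynomials, and let b be a vector of m such polynomials. For each positive integer t let R(t) = {x ∈ ℝ^n : A(t)x ≤ b(t)} and let L(t) = R(t) ∩ ℤ^n; assume R(t) is bounded for every positive integer t. For each positive integer ℓ, let f_ℓ(t) be the ℓ-th largest value with multiplicity of the objective c(t)·x over x ∈ L(t), or −∞ if |L(t)| < ℓ. Then for every ℓ, the function f_ℓ is eventually quasi-polynomial. -/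
/-- Evaluation of an integer polynomial at a positive integer `t`. -/
def evalAt (p : Polynomial ℤ) (t : ℕ) : ℤ := p.eval (t : ℤ)

/-- Eventual quasi-polynomiality for functions with values in `ℤ ∪ {−∞}`:
on each residue class mod the period, the function eventually agrees with a
rational polynomial or is eventually `−∞`. -/
def IsEQPBot (f : ℕ → WithBot ℤ) : Prop :=
  ∃ d : ℕ, 0 < d ∧ ∀ r : ℕ, r < d →
    (∃ R : Polynomial ℚ, ∃ N : ℕ, ∀ t : ℕ, N ≤ t → t % d = r →
      ∃ z : ℤ, f t = (z : WithBot ℤ) ∧ (z : ℚ) = R.eval (t : ℚ)) ∨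
    (∃ N : ℕ, ∀ t : ℕ, N ≤ t → t % d = r → f t = ⊥)

/-- `v` is the `ℓ`-th largest value, with multiplicity, of the objective `obj`
over the set `S` (and `v = ⊥` when `S` has fewer than `ℓ` elements). -/
def IsKthLargest {α : Type*} (S : Set α) (obj : α → ℤ) (ℓ : ℕ) (v : WithBot ℤ) : Prop :=
  (S.ncard < ℓ ∧ v = ⊥) ∨
  (ℓ ≤ S.ncard ∧ ∃ z : ℤ, v = (z : WithBot ℤ) ∧
    {x ∈ S | z < obj x}.ncard < ℓ ∧ ℓ ≤ {x ∈ S | z ≤ obj x}.ncard)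


namespace KthEQP

section Dig
variable {M : Type} [AddCommMonoid M]

/-- affine integer-valued function, bounded by a multiple of `τ` on `D` -/
def BA (τ : M →+ ℕ) (D : Set M) (L : M → ℤ) : Prop :=
  (∃ φ : M →+ ℤ, ∃ c : ℤ, ∀ v, L v = c + φ v) ∧ ∃ C : ℕ, ∀ v ∈ D, |L v| ≤ C * (τ v : ℤ)

inductive Dig (τ : M →+ ℕ) (D : Set M) : (M → ℤ) → Prop
  | aff {L : M → ℤ} : BA τ D L → Dig τ D L
  | step {L G : M → ℤ} : BA τ D L → Dig τ D G → Dig τ D (fun v => L v + (τ v : ℤ) * G v)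

variable {τ : M →+ ℕ} {D : Set M}

lemma BA.add {L L' : M → ℤ} (h : BA τ D L) (h' : BA τ D L') : BA τ D (fun v => L v + L' v) := by
  obtain ⟨⟨φ, c, h1⟩, C, h2⟩ := h
  obtain ⟨⟨φ', c', h1'⟩, C', h2'⟩ := h'
  refine ⟨⟨φ + φ', c + c', fun v => ?_⟩, C + C', fun v hv => ?_⟩
  · simp only [h1, h1', AddMonoidHom.add_apply]; ring
  · have := abs_add_le (L v) (L' v)
    have := h2 v hv
    have := h2' v hv
    push_cast
    linarith

lemma BA.smul {L : M → ℤ} (a : ℤ) (h : BA τ D L) : BA τ D (fun v => a * L v) := by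
  obtain ⟨⟨φ, c, h1⟩, C, h2⟩ := h
  refine ⟨⟨a • φ, a * c, fun v => ?_⟩, a.natAbs * C, fun v hv => ?_⟩
  · simp only [h1, AddMonoidHom.smul_apply, smul_eq_mul]; ring
  · rw [abs_mul]
    push_cast
    rw [mul_assoc]
    exact mul_le_mul_of_nonneg_left (h2 v hv) (abs_nonneg a)

lemma BA.const (hD : ∀ v ∈ D, 1 ≤ τ v) (a : ℤ) : BA τ D (fun _ => a) := by
  refine ⟨⟨0, a, fun v => by simp⟩, a.natAbs, fun v hv => ?_⟩
  have : (1 : ℤ) ≤ τ v := by exact_mod_cast hD v hv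
  push_cast
  nlinarith [abs_nonneg a]

lemma Dig.smul {F : M → ℤ} (a : ℤ) (h : Dig τ D F) : Dig τ D (fun v => a * F v) := by
  induction h with
  | aff h => exact .aff (h.smul a)
  | step hL _ ih =>
    convert Dig.step (hL.smul a) ih using 2
    ring

lemma Dig.addBA {F L : M → ℤ} (h : Dig τ D F) (hL : BA τ D L) : Dig τ D (fun v => F v + L v) := by
  cases h with
  | aff h => exact .aff (h.add hL)
  | step hL' hG =>
    convert Dig.step (hL'.add hL) hG using 2
    ring

lemma Dig.add {F F' : M → ℤ} (h : Dig τ D F) (h' : Dig τ D F') :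
    Dig τ D (fun v => F v + F' v) := by
  induction h generalizing F' with
  | aff h =>
    convert h'.addBA h using 2
    ring
  | step hL hG ih =>
    cases h' with
    | aff h' => exact (Dig.step hL hG).addBA h'
    | step hL' hG' =>
      convert Dig.step (hL.add hL') (ih hG') using 2
      ring

lemma Dig.zero : Dig τ D (fun _ => 0) :=
  .aff ⟨⟨0, 0, fun v => by simp⟩, 0, fun v _ => by simp⟩

lemma Dig.sum {ι : Type} (s : Finset ι) {F : ι → M → ℤ} (h : ∀ i ∈ s, Dig τ D (F i)) :
    Dig τ D (fun v => ∑ i ∈ s, F i v) := by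
  classical
  induction s using Finset.induction_on with
  | empty => simpa using Dig.zero
  | insert a s ha ih =>
    simp_rw [Finset.sum_insert ha]
    exact (h a (by simp)).add (ih fun i hi => h i (by simp [hi]))

lemma Dig.mulT {F : M → ℤ} (h : Dig τ D F) : Dig τ D (fun v => (τ v : ℤ) * F v) := by
  have h0 : BA τ D (fun _ => 0) := ⟨⟨0, 0, fun v => by simp⟩, 0, fun v _ => by simp⟩
  convert Dig.step h0 h using 2
  ring

lemma Dig.mulPow {F : M → ℤ} (h : Dig τ D F) (k : ℕ) :
    Dig τ D (fun v => (τ v : ℤ) ^ k * F v) := by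
  induction k with
  | zero => simpa using h
  | succ k ih =>
    convert ih.mulT using 2
    ring

lemma Dig.mulPoly {F : M → ℤ} (h : Dig τ D F) (p : Polynomial ℤ) :
    Dig τ D (fun v => p.eval (τ v : ℤ) * F v) := by
  simp_rw [Polynomial.eval_eq_sum_range, Finset.sum_mul, mul_assoc]
  exact Dig.sum _ fun i _ => (h.mulPow i).smul _

lemma Dig.poly (hD : ∀ v ∈ D, 1 ≤ τ v) (p : Polynomial ℤ) :
    Dig τ D (fun v => p.eval (τ v : ℤ)) := by
  simpa using (Dig.aff (BA.const hD 1)).mulPoly p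

lemma semilin_Iic (q : ℤ) : IsSemilinearSet {z : ℤ | z ≤ q} := by
  apply IsLinearSet.isSemilinearSet
  refine ⟨q, {-1}, Set.finite_singleton _, ?_⟩
  ext z
  simp only [Set.mem_ofPred_eq, Set.mem_vadd_set, SetLike.mem_coe,
    AddSubmonoid.mem_closure_singleton]
  constructor
  · intro h
    refine ⟨z - q, ⟨(q - z).toNat, ?_⟩, by simp⟩
    simp
    omega
  · rintro ⟨y, ⟨n, rfl⟩, rfl⟩
    simp

variable [AddMonoid.FG M]

lemma semilin_aff {L : M → ℤ} (h : ∃ φ : M →+ ℤ, ∃ c : ℤ, ∀ v, L v = c + φ v) (q : ℤ) :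
    IsSemilinearSet {v | L v ≤ q} := by
  obtain ⟨φ, c, h⟩ := h
  convert (semilin_Iic (q - c)).preimage φ using 1
  ext v
  simp only [Set.mem_ofPred_eq, Set.mem_preimage, h]
  constructor <;> intro <;> linarith

lemma semilin_dig (hDs : IsSemilinearSet D) (hD : ∀ v ∈ D, 1 ≤ τ v) {F : M → ℤ}
    (h : Dig τ D F) : ∀ q : ℤ, IsSemilinearSet (D ∩ {v | F v ≤ q}) := by
  induction h with
  | aff h => exact fun q => hDs.inter (semilin_aff h.1 q)
  | @step L G hL hG ih =>
    intro q
    obtain ⟨φ, c, h1⟩ := hL.1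
    obtain ⟨C, h2⟩ := (hL.smul (-1)).add (BA.const hD q) |>.2
    have key : D ∩ {v | L v + (τ v : ℤ) * G v ≤ q} =
        ⋃ k ∈ Finset.Icc (-(C : ℤ)) C,
          (({v | L v + k * (τ v : ℤ) ≤ q} ∩ {v | -L v - (k + 1) * (τ v : ℤ) ≤ -q - 1}) ∩
          (D ∩ {v | G v ≤ k})) := by
      ext v
      simp only [Set.mem_inter_iff, Set.mem_ofPred_eq, Set.mem_iUnion, Finset.mem_Icc, exists_prop]
      constructor
      · rintro ⟨hv, hq⟩
        have ht : (1 : ℤ) ≤ τ v := by exact_mod_cast hD v hv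
        have h3 := abs_le.1 (h2 v hv)
        have e1 := Int.emod_add_mul_ediv (q - L v) (τ v)
        have e2 := Int.emod_nonneg (q - L v) (b := (τ v : ℤ)) (by omega)
        have e3 := Int.emod_lt_of_pos (q - L v) (b := (τ v : ℤ)) (by omega)
        refine ⟨(q - L v) / (τ v), ⟨?_, ?_⟩, ⟨?_, ?_⟩, hv, ?_⟩
        · rw [Int.le_ediv_iff_mul_le (by omega)]; linarith [h3.1]
        · apply Int.ediv_le_of_le_mul (by omega); linarith [h3.2]
        · linarith
        · linarith
        · rw [Int.le_ediv_iff_mul_le (by omega)]; linarith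
      · rintro ⟨k, -, ⟨h3, h4⟩, hv, h5⟩
        refine ⟨hv, ?_⟩
        have ht : (0 : ℤ) ≤ τ v := by positivity
        nlinarith
    rw [key]
    refine .biUnion_finset fun k _ => .inter (.inter ?_ ?_) (ih k)
    · refine semilin_aff ⟨φ + k • ((Nat.castAddMonoidHom ℤ).comp τ), c, fun v => ?_⟩ q
      simp [h1]; ring
    · refine semilin_aff ⟨-φ - (k + 1) • ((Nat.castAddMonoidHom ℤ).comp τ), -c, fun v => ?_⟩ _
      simp [h1]; ring
end Dig

end KthEQP


namespace KthEQP

section Good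

set_option linter.unusedSectionVars false

/-- the integer represented by a digit vector in base `t`, shifted -/
def val (K : ℕ) (t : ℕ) (d : Fin (K + 2) → ℕ) : ℤ :=
  ∑ k : Fin (K + 2), (t : ℤ) ^ (k : ℕ) * (d k : ℤ) - (t : ℤ) ^ K

abbrev Mon (K : ℕ) (β : Type) : Type := ℕ × (β → Fin (K + 2) → ℕ)

def Dom (K : ℕ) (β : Type) : Set (Mon K β) := {v | 1 ≤ v.1 ∧ ∀ b k, v.2 b k < v.1}

/-- integers representable with digits -/
def Rng (K t : ℕ) (z : ℤ) : Prop := ∃ d : Fin (K + 2) → ℕ, (∀ k, d k < t) ∧ val K t d = z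

def Good (K : ℕ) {β : Type} (P : ℕ → (β → ℤ) → Prop) : Prop :=
  IsSemilinearSet {v : Mon K β | v ∈ Dom K β ∧ P v.1 (fun b => val K v.1 (v.2 b))}

lemma val_inj {K t : ℕ} {d d' : Fin (K + 2) → ℕ} (h : ∀ k, d k < t) (h' : ∀ k, d' k < t)
    (e : val K t d = val K t d') : d = d' := by
  have key : finFunctionFinEquiv (fun k => (⟨d k, h k⟩ : Fin t)) =
      finFunctionFinEquiv (fun k => (⟨d' k, h' k⟩ : Fin t)) := by
    apply Fin.ext
    rw [finFunctionFinEquiv_apply, finFunctionFinEquiv_apply]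
    simp only [val, sub_left_inj] at e
    have e' : ∑ k : Fin (K + 2), d k * t ^ (k : ℕ) = ∑ k : Fin (K + 2), d' k * t ^ (k : ℕ) := by
      simp only [mul_comm _ (t ^ _)]
      exact_mod_cast e
    exact e'
  have := finFunctionFinEquiv.injective key
  funext k
  have := congrFun this k
  simpa using this

lemma rng_of_abs_le {K t : ℕ} (ht : 2 ≤ t) {z : ℤ} (hz : |z| ≤ (t : ℤ) ^ K) : Rng K t z := by
  obtain ⟨h1, h2⟩ := abs_le.1 hz
  have ht' : (2 : ℤ) ≤ t := by exact_mod_cast ht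
  have hpos : (0 : ℤ) < (t : ℤ) ^ K := by positivity
  have h3 : z + (t : ℤ) ^ K < (t : ℤ) ^ (K + 2) := by
    rw [pow_add]
    have : (t : ℤ) ^ K * 4 ≤ (t : ℤ) ^ K * (t : ℤ) ^ 2 :=
      mul_le_mul_of_nonneg_left (by nlinarith) hpos.le
    linarith
  obtain ⟨w, hw⟩ := Int.eq_ofNat_of_zero_le (a := z + (t : ℤ) ^ K) (by linarith)
  have hwt : w < t ^ (K + 2) := by
    rw [hw] at h3; exact_mod_cast h3
  let g := finFunctionFinEquiv.symm (⟨w, hwt⟩ : Fin (t ^ (K + 2)))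
  refine ⟨fun k => (g k : ℕ), fun k => (g k).2, ?_⟩
  have hg : (finFunctionFinEquiv g : ℕ) = w := by simp [g]
  rw [finFunctionFinEquiv_apply] at hg
  have : ∑ k : Fin (K + 2), (t : ℤ) ^ (k : ℕ) * ((g k : ℕ) : ℤ) = w := by
    have hg' : ∑ k : Fin (K + 2), t ^ (k : ℕ) * (g k : ℕ) = w := by
      rw [← hg]
      exact Finset.sum_congr rfl fun k _ => mul_comm _ _
    exact_mod_cast hg'
  simp only [val]
  rw [this]; linarith [hw]

variable {K : ℕ} {β γ : Type} [Finite β] [Finite γ]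

lemma FG_mon (K : ℕ) (β : Type) [Finite β] : AddMonoid.FG (Mon K β) := inferInstance

lemma good_dom : IsSemilinearSet (Dom K β) := by
  have e : Dom K β = {v | -(v.1 : ℤ) ≤ -1} ∩ ⋂ b, ⋂ k, {v | (v.2 b k : ℤ) - v.1 ≤ -1} := by
    ext v
    simp only [Dom, Set.mem_ofPred_eq, Set.mem_inter_iff, Set.mem_iInter]
    refine and_congr (by omega) (forall_congr' fun b => forall_congr' fun k => by omega)
  rw [e]
  let τ : Mon K β →+ ℤ := (Nat.castAddMonoidHom ℤ).comp (AddMonoidHom.fst _ _)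
  let π (b : β) (k : Fin (K + 2)) : Mon K β →+ ℤ := (Nat.castAddMonoidHom ℤ).comp
    (((Pi.evalAddMonoidHom (fun _ => ℕ) k).comp
      (Pi.evalAddMonoidHom (fun _ => Fin (K+2) → ℕ) b)).comp (AddMonoidHom.snd _ _))
  refine .inter ?_ (.iInter fun b => .iInter fun k => ?_)
  · exact semilin_aff ⟨-τ, 0, fun v => by simp [τ]⟩ _
  · exact semilin_aff ⟨π b k - τ, 0, fun v => by simp [τ, π]⟩ _

lemma Good.not {P : ℕ → (β → ℤ) → Prop} (h : Good K P) : Good K (fun t x => ¬ P t x) := by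
  unfold Good at *
  convert (good_dom (K := K) (β := β)).sdiff h using 1
  ext v
  simp only [Set.mem_ofPred_eq, Set.mem_sdiff]
  tauto

lemma Good.and {P Q : ℕ → (β → ℤ) → Prop} (h : Good K P) (h' : Good K Q) :
    Good K (fun t x => P t x ∧ Q t x) := by
  unfold Good at *
  convert h.inter h' using 1
  ext v
  simp only [Set.mem_ofPred_eq, Set.mem_inter_iff]
  tauto

lemma Good.or {P Q : ℕ → (β → ℤ) → Prop} (h : Good K P) (h' : Good K Q) :
    Good K (fun t x => P t x ∨ Q t x) := by
  unfold Good at *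
  convert h.union h' using 1
  ext v
  simp only [Set.mem_ofPred_eq, Set.mem_union]
  tauto

lemma Good.exi {ι : Type} [Finite ι] {P : ι → ℕ → (β → ℤ) → Prop} (h : ∀ i, Good K (P i)) :
    Good K (fun t x => ∃ i, P i t x) := by
  unfold Good at *
  convert IsSemilinearSet.iUnion h using 1
  ext v
  simp

lemma Good.all {ι : Type} [Finite ι] {P : ι → ℕ → (β → ℤ) → Prop} (h : ∀ i, Good K (P i)) :
    Good K (fun t x => ∀ i, P i t x) := by
  convert (Good.exi fun i => (h i).not).not using 3
  simp

lemma Good.imp_const {P : ℕ → (β → ℤ) → Prop} (p : Prop) (h : Good K P) :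
    Good K (fun t x => p → P t x) := by
  by_cases hp : p
  · simpa [hp] using h
  · simpa [hp, Good] using good_dom

lemma Good.comap {P : ℕ → (β → ℤ) → Prop} (h : Good K P) (e : β → γ) :
    Good K (fun t (x : γ → ℤ) => P t (fun b => x (e b))) := by
  unfold Good at *
  let φ : Mon K γ →+ Mon K β :=
    { toFun := fun v => (v.1, fun b => v.2 (e b))
      map_zero' := rfl
      map_add' := fun v w => rfl }
  convert (h.preimage φ).inter good_dom using 1
  ext v
  simp only [Set.mem_ofPred_eq, Set.mem_inter_iff, Set.mem_preimage, φ, AddMonoidHom.coe_mk, ZeroHom.coe_mk, Dom]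
  constructor
  · rintro ⟨⟨h1, h2⟩, h3⟩
    exact ⟨⟨⟨h1, fun b => h2 _⟩, h3⟩, h1, h2⟩
  · rintro ⟨⟨⟨h1, h2⟩, h3⟩, h4⟩
    exact ⟨h4, h3⟩

lemma Good.proj {P : ℕ → (β ⊕ γ → ℤ) → Prop} (h : Good K P) :
    Good K (fun t (x : β → ℤ) => ∃ y : γ → ℤ, (∀ c, Rng K t (y c)) ∧ P t (Sum.elim x y)) := by
  unfold Good at *
  let φ : Mon K (β ⊕ γ) →+ Mon K β :=
    { toFun := fun v => (v.1, fun b => v.2 (Sum.inl b))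
      map_zero' := rfl
      map_add' := fun v w => rfl }
  convert h.image φ using 1
  ext v
  simp only [Set.mem_ofPred_eq, Set.mem_image, φ, AddMonoidHom.coe_mk, ZeroHom.coe_mk]
  constructor
  · rintro ⟨⟨h1, h2⟩, y, hy, hP⟩
    choose d hd hd' using hy
    refine ⟨(v.1, Sum.elim v.2 d), ⟨⟨h1, ?_⟩, ?_⟩, ?_⟩
    · rintro (b | c) k
      · exact h2 b k
      · exact hd c k
    · convert hP using 1
      funext b
      rcases b with b | c
      · rfl
      · exact hd' c
    · rfl
  · rintro ⟨w, ⟨⟨h1, h2⟩, h3⟩, rfl⟩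
    refine ⟨⟨h1, fun b k => h2 _ _⟩, fun c => val K w.1 (w.2 (Sum.inr c)),
      fun c => ⟨_, h2 _, rfl⟩, ?_⟩
    convert h3 using 1
    funext b
    rcases b with b | c <;> rfl

lemma Good.lin {β : Type} [Fintype β] (a : β → Polynomial ℤ) (c : Polynomial ℤ) :
    Good K (fun t (x : β → ℤ) => ∑ b, (a b).eval (t : ℤ) * x b ≤ c.eval (t : ℤ)) := by
  let τ : Mon K β →+ ℕ := AddMonoidHom.fst _ _
  have hD : ∀ v ∈ Dom K β, 1 ≤ τ v := fun v hv => hv.1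
  let π (b : β) (k : Fin (K + 2)) : Mon K β →+ ℤ := (Nat.castAddMonoidHom ℤ).comp
    (((Pi.evalAddMonoidHom (fun _ => ℕ) k).comp
      (Pi.evalAddMonoidHom (fun _ => Fin (K+2) → ℕ) b)).comp (AddMonoidHom.snd _ _))
  have hdig (b : β) (k : Fin (K + 2)) : Dig τ (Dom K β) (fun v => (v.2 b k : ℤ)) := by
    refine .aff ⟨⟨π b k, 0, fun v => by simp [π]⟩, 1, fun v hv => ?_⟩
    have := hv.2 b k
    have : (v.2 b k : ℤ) < v.1 := by exact_mod_cast this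
    simp only [Nat.abs_cast, Nat.cast_one, one_mul]
    exact this.le
  have hval (b : β) : Dig τ (Dom K β) (fun v => val K v.1 (v.2 b)) := by
    have := (Dig.sum Finset.univ fun k _ => (hdig b k).mulPow (k : ℕ)).add
      ((Dig.poly hD (Polynomial.X ^ K)).smul (-1))
    convert this using 2
    simp [val, τ, sub_eq_add_neg]
  have hF := (Dig.sum Finset.univ fun b _ => (hval b).mulPoly (a b)).add
    ((Dig.poly hD c).smul (-1))
  have := semilin_dig good_dom hD hF 0
  unfold Good
  convert this using 1
  ext v
  simp only [Set.mem_ofPred_eq, Set.mem_inter_iff]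
  refine and_congr Iff.rfl ?_
  simp only [τ, AddMonoidHom.coe_fst]
  constructor <;> intro <;> linarith

end Good

end KthEQP

namespace KthEQP

open scoped Pointwise

lemma linear_functional {α : Type} {G : Set (ℕ × (α → ℕ))} (hG : IsLinearSet G)
    (hf : ∀ t v w, (t, v) ∈ G → (t, w) ∈ G → v = w) :
    ∃ p : ℕ, 0 < p ∧ ((∃ N, ∀ t v, (t, v) ∈ G → t ≤ N) ∨
      (∃ a b : α → ℚ, (∀ t v, (t, v) ∈ G → ∃ w, (t + p, w) ∈ G) ∧
        ∀ t v, (t, v) ∈ G → ∀ i, (v i : ℚ) = a i * t + b i)) := by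
  obtain ⟨a, T, -, rfl⟩ := hG
  by_cases h : ∀ e ∈ T, e.1 = 0
  · refine ⟨1, one_pos, Or.inl ⟨a.1, ?_⟩⟩
    rintro t v ⟨g, hg, hgv⟩
    have hg0 : g.1 = 0 := by
      have : AddSubmonoid.closure T ≤ (AddMonoidHom.mker (AddMonoidHom.fst ℕ (α → ℕ))) := by
        rw [AddSubmonoid.closure_le]
        intro e he
        exact AddMonoidHom.mem_mker.2 (h e he)
      exact AddMonoidHom.mem_mker.1 (this hg)
    have := congrArg Prod.fst hgv
    simp [hg0] at this
    omega
  · push Not at h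
    obtain ⟨e, he, hp⟩ := h
    have hemem := AddSubmonoid.subset_closure he
    refine ⟨e.1, Nat.pos_of_ne_zero hp, Or.inr ⟨fun i => (e.2 i : ℚ) / e.1,
      fun i => a.2 i - (e.2 i : ℚ) / e.1 * a.1, ?_, ?_⟩⟩
    · rintro t v ⟨g, hg, hgv⟩
      refine ⟨v + e.2, g + e, add_mem hg hemem, ?_⟩
      simp only [vadd_eq_add] at hgv ⊢
      rw [← add_assoc, hgv]
      rfl
    · rintro t v ⟨g, hg, hgv⟩ i
      simp only [vadd_eq_add] at hgv
      have h1 : a + e.1 • g ∈ a +ᵥ (AddSubmonoid.closure T : Set (ℕ × (α → ℕ))) :=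
        ⟨_, nsmul_mem hg _, rfl⟩
      have h2 : a + g.1 • e ∈ a +ᵥ (AddSubmonoid.closure T : Set (ℕ × (α → ℕ))) :=
        ⟨_, nsmul_mem hemem _, rfl⟩
      have e1 : a + e.1 • g = (a.1 + e.1 * g.1, a.2 + e.1 • g.2) := by ext <;> simp
      have e2 : a + g.1 • e = (a.1 + e.1 * g.1, a.2 + g.1 • e.2) := by
        ext <;> simp [mul_comm]
      rw [e1] at h1
      rw [e2] at h2
      have h3 := congrFun (hf _ _ _ h1 h2) i
      simp only [Pi.add_apply, Pi.smul_apply, smul_eq_mul, add_right_inj] at h3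
      have h3' : (e.1 : ℚ) * g.2 i = g.1 * e.2 i := by exact_mod_cast h3
      have ht : a.1 + g.1 = t := congrArg Prod.fst hgv
      have hv : a.2 i + g.2 i = v i := congrFun (congrArg Prod.snd hgv) i
      rw [← ht, ← hv]
      push_cast
      have hp' : (e.1 : ℚ) ≠ 0 := by exact_mod_cast hp
      field_simp
      linarith

lemma semilinear_functional {α : Type} {G : Set (ℕ × (α → ℕ))} (hG : IsSemilinearSet G)
    (hf : ∀ t v w, (t, v) ∈ G → (t, w) ∈ G → v = w) :
    ∃ d : ℕ, 0 < d ∧ ∀ r : ℕ, r < d →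
      (∃ a b : α → ℚ, ∃ N : ℕ, ∀ t, N ≤ t → t % d = r → ∃ v, (t, v) ∈ G ∧
        ∀ i, (v i : ℚ) = a i * t + b i) ∨
      (∃ N : ℕ, ∀ t, N ≤ t → t % d = r → ∀ v, (t, v) ∉ G) := by
  classical
  obtain ⟨S, hS, rfl⟩ := isSemilinearSet_iff.1 hG
  have H : ∀ s : S, _ := fun s => linear_functional (hS s.1 s.2)
    (fun t v w h1 h2 => hf t v w ⟨s.1, s.2, h1⟩ ⟨s.1, s.2, h2⟩)
  choose p hp H using H
  have hd : 0 < ∏ s, p s := Finset.prod_pos fun s _ => hp s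
  refine ⟨∏ s, p s, hd, fun r hr => ?_⟩
  by_cases hc : ∃ s : S, ∃ a b : α → ℚ, (∀ t v, (t, v) ∈ s.1 → ∃ w, (t + p s, w) ∈ s.1) ∧
        (∀ t v, (t, v) ∈ s.1 → ∀ i, (v i : ℚ) = a i * t + b i) ∧
        ∃ t v, (t, v) ∈ s.1 ∧ t % (∏ s, p s) = r
  · left
    obtain ⟨s, a, b, h1, h2, t0, v0, h0, hr0⟩ := hc
    have hstep : ∀ k : ℕ, ∃ w, (t0 + p s * k, w) ∈ s.1 := by
      intro k
      induction k with
      | zero => exact ⟨v0, h0⟩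
      | succ k ih =>
        obtain ⟨w, hw⟩ := ih
        obtain ⟨w', hw'⟩ := h1 _ _ hw
        exact ⟨w', by rw [mul_add, mul_one, ← add_assoc]; exact hw'⟩
    refine ⟨a, b, t0, fun t ht htr => ?_⟩
    have hdvd : (∏ s, p s) ∣ t - t0 := (Nat.modEq_iff_dvd' ht).1 (hr0.trans htr.symm)
    obtain ⟨k, hk⟩ := (Finset.dvd_prod_of_mem p (Finset.mem_univ s)).trans hdvd
    obtain ⟨w, hw⟩ := hstep k
    have : t0 + p s * k = t := by omega
    rw [this] at hw
    exact ⟨w, ⟨s.1, s.2, hw⟩, h2 _ _ hw⟩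
  · right
    have HN : ∀ s : S, ∃ N, ∀ t v, (t, v) ∈ s.1 → t % (∏ s, p s) = r → t ≤ N := by
      intro s
      rcases H s with ⟨N, hN⟩ | ⟨a, b, h1, h2⟩
      · exact ⟨N, fun t v h _ => hN t v h⟩
      · exact ⟨0, fun t v h h' => (hc ⟨s, a, b, h1, h2, t, v, h, h'⟩).elim⟩
    choose N hN using HN
    refine ⟨∑ s, N s + 1, fun t ht htr v => ?_⟩
    rintro ⟨s, hs, hv⟩
    have h1 := hN ⟨s, hs⟩ t v hv htr
    have h2 := Finset.single_le_sum (f := N) (fun _ _ => Nat.zero_le _)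
      (Finset.mem_univ (⟨s, hs⟩ : S))
    omega

lemma good_eqp {K : ℕ} {Q : ℕ → (Unit → ℤ) → Prop} (h : Good K Q)
    (hu : ∀ t x y, Rng K t (x ()) → Rng K t (y ()) → Q t x → Q t y → x = y) (f : ℕ → WithBot ℤ) (N0 : ℕ)
    (h1 : ∀ t, N0 ≤ t → ∀ z : ℤ, f t = z → Q t (fun _ => z) ∧ Rng K t z)
    (h2 : ∀ t, N0 ≤ t → f t = ⊥ → ∀ z : ℤ, ¬ Q t (fun _ => z)) : IsEQPBot f := by
  let e : Mon K Unit →+ ℕ × (Fin (K + 2) → ℕ) :=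
    { toFun := fun v => (v.1, v.2 ())
      map_zero' := rfl
      map_add' := fun v w => rfl }
  have hG := IsSemilinearSet.image h e
  have hmem : ∀ t d, (t, d) ∈ e '' {v : Mon K Unit | v ∈ Dom K Unit ∧
      Q v.1 (fun b => val K v.1 (v.2 b))} ↔
      1 ≤ t ∧ (∀ k, d k < t) ∧ Q t (fun _ => val K t d) := by
    intro t d
    constructor
    · rintro ⟨v, ⟨⟨h1, h2⟩, h3⟩, h4⟩
      simp only [e, AddMonoidHom.coe_mk, ZeroHom.coe_mk, Prod.mk.injEq] at h4
      obtain ⟨rfl, rfl⟩ := h4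
      exact ⟨h1, h2 (), h3⟩
    · rintro ⟨h1, h2, h3⟩
      exact ⟨(t, fun _ => d), ⟨⟨h1, fun _ => h2⟩, h3⟩, rfl⟩
  obtain ⟨d, hd, H⟩ := semilinear_functional hG (by
    intro t v w hv hw
    rw [hmem] at hv hw
    exact val_inj hv.2.1 hw.2.1 (congrFun (hu _ _ _ ⟨v, hv.2.1, rfl⟩ ⟨w, hw.2.1, rfl⟩ hv.2.2 hw.2.2) ()))
  refine ⟨d, hd, fun r hr => ?_⟩
  rcases H r hr with ⟨a, b, N, hN⟩ | ⟨N, hN⟩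
  · left
    refine ⟨∑ k : Fin (K + 2), Polynomial.X ^ (k : ℕ) *
      (Polynomial.C (a k) * Polynomial.X + Polynomial.C (b k)) - Polynomial.X ^ K,
      max N N0, fun t ht htr => ?_⟩
    obtain ⟨v, hv, hva⟩ := hN t (le_trans (le_max_left _ _) ht) htr
    rw [hmem] at hv
    have ht0 := le_trans (le_max_right _ _) ht
    cases hft : f t with
    | bot => exact (h2 t ht0 hft _ hv.2.2).elim
    | coe z =>
      refine ⟨z, rfl, ?_⟩
      have := congrFun (hu _ _ _ (h1 t ht0 z hft).2 ⟨v, hv.2.1, rfl⟩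
        (h1 t ht0 z hft).1 hv.2.2) ()
      rw [this]
      simp [val, Polynomial.eval_finsetSum, hva]
  · right
    refine ⟨max (max N N0) 1, fun t ht htr => ?_⟩
    have ha : N ≤ t := le_trans ((le_max_left _ _).trans (le_max_left _ _)) ht
    have hb : N0 ≤ t := le_trans ((le_max_right _ _).trans (le_max_left _ _)) ht
    cases hft : f t with
    | bot => rfl
    | coe z =>
      obtain ⟨hq, dd, hdd, rfl⟩ := h1 t hb z hft
      exact (hN t ha htr dd ((hmem _ _).2 ⟨le_trans (le_max_right _ _) ht, hdd, hq⟩)).elim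

end KthEQP


namespace KthEQP
open Polynomial

lemma poly_sign (p : ℤ[X]) : ∃ N : ℕ, (∀ t : ℕ, N ≤ t → p.eval (t : ℤ) = 0) ∨
    (∀ t : ℕ, N ≤ t → 0 < p.eval (t : ℤ)) ∨ (∀ t : ℕ, N ≤ t → p.eval (t : ℤ) < 0) := by
  by_cases h0 : p = 0
  · exact ⟨0, Or.inl (by simp [h0])⟩
  have main : ∀ q : ℤ[X], 0 < q.leadingCoeff → ∃ N : ℕ, ∀ t : ℕ, N ≤ t → 0 < q.eval (t : ℤ) := by
    intro q hq
    let Q : ℝ[X] := q.map (Int.castRingHom ℝ)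
    have hlc : Q.leadingCoeff = q.leadingCoeff :=
      leadingCoeff_map_of_injective (RingHom.injective_int _) q
    have hev : ∀ t : ℕ, Q.eval (t : ℝ) = ((q.eval (t : ℤ) : ℤ) : ℝ) := by
      intro t
      simp [Q]
    have hev2 : ∀ᶠ x : ℝ in Filter.atTop, 0 < Q.eval x := by
      have hl : 0 < Q.leadingCoeff := by rw [hlc]; exact_mod_cast hq
      by_cases hdeg : 0 < Q.degree
      · exact (Polynomial.tendsto_atTop_of_leadingCoeff_nonneg Q hdeg hl.le).eventually_gt_atTop 0
      · have hc := Polynomial.eq_C_of_degree_le_zero (not_lt.1 hdeg)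
        rw [hc] at hl ⊢
        rw [leadingCoeff_C] at hl
        exact Filter.Eventually.of_forall fun x => by rw [eval_C]; exact hl
    obtain ⟨N, hN⟩ := Filter.eventually_atTop.1
      (tendsto_natCast_atTop_atTop.eventually hev2)
    refine ⟨N, fun t ht => ?_⟩
    have := hN t ht
    rw [hev] at this
    exact_mod_cast this
  rcases lt_trichotomy p.leadingCoeff 0 with h | h | h
  · obtain ⟨N, hN⟩ := main (-p) (by simpa using h)
    exact ⟨N, Or.inr (Or.inr fun t ht => by simpa using hN t ht)⟩
  · exact (h0 (leadingCoeff_eq_zero.1 h)).elim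
  · obtain ⟨N, hN⟩ := main p h
    exact ⟨N, Or.inr (Or.inl hN)⟩

lemma poly_bound (p : ℤ[X]) : ∃ K N : ℕ, ∀ K', K ≤ K' → ∀ t : ℕ, N ≤ t →
    |p.eval (t : ℤ)| ≤ (t : ℤ) ^ K' := by
  refine ⟨p.natDegree + 1, (∑ i ∈ Finset.range (p.natDegree + 1), |p.coeff i|).toNat + 1,
    fun K' hK' t ht => ?_⟩
  have ht1 : (1 : ℤ) ≤ t := by omega
  have hC : ∑ i ∈ Finset.range (p.natDegree + 1), |p.coeff i| ≤ (t : ℤ) := by omega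
  calc |p.eval (t : ℤ)| ≤ ∑ i ∈ Finset.range (p.natDegree + 1), |p.coeff i * (t : ℤ) ^ i| := by
        rw [Polynomial.eval_eq_sum_range]; exact Finset.abs_sum_le_sum_abs _ _
    _ ≤ ∑ i ∈ Finset.range (p.natDegree + 1), |p.coeff i| * (t : ℤ) ^ p.natDegree := by
        refine Finset.sum_le_sum fun i hi => ?_
        rw [abs_mul, abs_of_nonneg (by positivity : (0 : ℤ) ≤ (t : ℤ) ^ i)]
        refine mul_le_mul_of_nonneg_left (pow_le_pow_right₀ ht1 ?_) (abs_nonneg _)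
        simp at hi; omega
    _ = (∑ i ∈ Finset.range (p.natDegree + 1), |p.coeff i|) * (t : ℤ) ^ p.natDegree := by
        rw [Finset.sum_mul]
    _ ≤ (t : ℤ) * (t : ℤ) ^ p.natDegree := mul_le_mul_of_nonneg_right hC (by positivity)
    _ = (t : ℤ) ^ (p.natDegree + 1) := by ring
    _ ≤ (t : ℤ) ^ K' := pow_le_pow_right₀ ht1 hK'

lemma exists_between_fin {ι κ : Type} [Finite ι] [Finite κ] (l : ι → ℝ) (u : κ → ℝ)
    (h : ∀ i k, l i ≤ u k) : ∃ y, (∀ i, l i ≤ y) ∧ ∀ k, y ≤ u k := by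
  cases isEmpty_or_nonempty ι
  · cases isEmpty_or_nonempty κ
    · exact ⟨0, fun i => isEmptyElim i, fun k => isEmptyElim k⟩
    · obtain ⟨k, hk⟩ := Finite.exists_min u
      exact ⟨u k, fun i => isEmptyElim i, hk⟩
  · obtain ⟨i, hi⟩ := Finite.exists_max l
    exact ⟨l i, hi, h i⟩

/-- real value of a polynomial at `t` -/
noncomputable def rv (p : ℤ[X]) (t : ℕ) : ℝ := ((p.eval (t : ℤ) : ℤ) : ℝ)

/-- Fourier-Motzkin elimination, parametric -/
lemma fm (n : ℕ) : ∀ (ι : Type) [Finite ι] (a : ι → Fin n → ℤ[X]) (q b : ι → ℤ[X]),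
    ∃ (κ : Type) (_ : Finite κ) (q' b' : κ → ℤ[X]) (N : ℕ), ∀ t : ℕ, N ≤ t → ∀ y : ℝ,
      (∃ x : Fin n → ℝ, ∀ i, ∑ j, rv (a i j) t * x j + rv (q i) t * y ≤ rv (b i) t) ↔
      ∀ k, rv (q' k) t * y ≤ rv (b' k) t := by
  induction n with
  | zero =>
    intro ι _ a q b
    exact ⟨ι, inferInstance, q, b, 0, fun t _ y => by simp⟩
  | succ n ih =>
    intro ι _ a q b
    choose Ns hs using fun i => poly_sign (a i 0)
    obtain ⟨N1, hN1⟩ : ∃ N1, ∀ i, Ns i ≤ N1 := (Set.finite_range Ns).bddAbove.imp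
      fun N h i => h ⟨i, rfl⟩
    let Z := {i : ι // ∀ t : ℕ, Ns i ≤ t → (a i 0).eval (t : ℤ) = 0}
    let Pp := {i : ι // ∀ t : ℕ, Ns i ≤ t → 0 < (a i 0).eval (t : ℤ)}
    let Nn := {i : ι // ∀ t : ℕ, Ns i ≤ t → (a i 0).eval (t : ℤ) < 0}
    let a2 : Z ⊕ (Nn × Pp) → Fin n → ℤ[X] := Sum.elim (fun i j => a i.1 j.succ)
      (fun p j => a p.2.1 0 * a p.1.1 j.succ - a p.1.1 0 * a p.2.1 j.succ)
    let q2 : Z ⊕ (Nn × Pp) → ℤ[X] := Sum.elim (fun i => q i.1)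
      (fun p => a p.2.1 0 * q p.1.1 - a p.1.1 0 * q p.2.1)
    let b2 : Z ⊕ (Nn × Pp) → ℤ[X] := Sum.elim (fun i => b i.1)
      (fun p => a p.2.1 0 * b p.1.1 - a p.1.1 0 * b p.2.1)
    obtain ⟨κ, hκ, q', b', N2, H⟩ := ih _ a2 q2 b2
    refine ⟨κ, hκ, q', b', max N1 N2, fun t ht y => ?_⟩
    have ht1 : ∀ i, Ns i ≤ t := fun i => (hN1 i).trans ((le_max_left _ _).trans ht)
    rw [← H t ((le_max_right _ _).trans ht) y]
    have hz : ∀ i : Z, rv (a i.1 0) t = 0 := fun i => by simp [rv, i.2 t (ht1 _)]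
    have hp : ∀ i : Pp, 0 < rv (a i.1 0) t := fun i => by
      have := i.2 t (ht1 _); simp only [rv]; exact_mod_cast this
    have hn : ∀ i : Nn, rv (a i.1 0) t < 0 := fun i => by
      have := i.2 t (ht1 _); simp only [rv]; exact_mod_cast this
    -- combined inequality in terms of residuals
    have hcomb : ∀ (p : Nn × Pp) (x : Fin n → ℝ),
        (∑ j, rv (a2 (Sum.inr p) j) t * x j + rv (q2 (Sum.inr p)) t * y ≤ rv (b2 (Sum.inr p)) t) ↔
        rv (a p.2.1 0) t * (∑ j : Fin n, rv (a p.1.1 j.succ) t * x j + rv (q p.1.1) t * y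
            - rv (b p.1.1) t)
          ≤ rv (a p.1.1 0) t * (∑ j : Fin n, rv (a p.2.1 j.succ) t * x j + rv (q p.2.1) t * y
            - rv (b p.2.1) t) := by
      intro p x
      have e1 : ∑ j, rv (a2 (Sum.inr p) j) t * x j =
          rv (a p.2.1 0) t * ∑ j : Fin n, rv (a p.1.1 j.succ) t * x j -
          rv (a p.1.1 0) t * ∑ j : Fin n, rv (a p.2.1 j.succ) t * x j := by
        rw [Finset.mul_sum, Finset.mul_sum, ← Finset.sum_sub_distrib]
        refine Finset.sum_congr rfl fun j _ => ?_
        simp only [a2, Sum.elim_inr, rv, eval_sub, eval_mul]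
        push_cast; ring
      have e2 : rv (q2 (Sum.inr p)) t = rv (a p.2.1 0) t * rv (q p.1.1) t -
          rv (a p.1.1 0) t * rv (q p.2.1) t := by
        simp only [q2, Sum.elim_inr, rv, eval_sub, eval_mul]
        push_cast; ring
      have e3 : rv (b2 (Sum.inr p)) t = rv (a p.2.1 0) t * rv (b p.1.1) t -
          rv (a p.1.1 0) t * rv (b p.2.1) t := by
        simp only [b2, Sum.elim_inr, rv, eval_sub, eval_mul]
        push_cast; ring
      rw [e1, e2, e3]
      constructor <;> intro h <;> nlinarith
    constructor
    · rintro ⟨x, hx⟩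
      refine ⟨fun j => x j.succ, ?_⟩
      simp only [Fin.sum_univ_succ] at hx
      rintro (i | p)
      · have := hx i.1
        rw [hz i] at this
        simpa [a2, q2, b2] using this
      · rw [hcomb]
        have h1 := hx p.1.1
        have h2 := hx p.2.1
        have h3 := hn p.1
        have h4 := hp p.2
        nlinarith
    · rintro ⟨x, hx⟩
      let res : ι → ℝ := fun i => rv (b i) t -
        (∑ j : Fin n, rv (a i j.succ) t * x j + rv (q i) t * y)
      obtain ⟨x0, hl, hu⟩ := exists_between_fin (fun i : Nn => res i.1 / rv (a i.1 0) t)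
        (fun i : Pp => res i.1 / rv (a i.1 0) t) (by
          intro i k
          have := (hcomb (i, k) x).1 (hx (Sum.inr (i, k)))
          have h3 := hn i
          have h4 := hp k
          rw [div_le_iff_of_neg h3, div_mul_eq_mul_div, div_le_iff₀ h4]
          simp only [res]
          nlinarith)
      refine ⟨Fin.cons x0 x, fun i => ?_⟩
      simp only [Fin.sum_univ_succ, Fin.cons_zero, Fin.cons_succ]
      rcases hs i with h | h | h
      · have h1 := hz ⟨i, h⟩
        have h2 := hx (Sum.inl ⟨i, h⟩)
        simp only [a2, q2, b2, Sum.elim_inl] at h2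
        simp only at h1
        rw [h1]; linarith
      · have h1 := hp ⟨i, h⟩
        have h2 := hu ⟨i, h⟩
        simp only at h1 h2
        rw [le_div_iff₀ h1] at h2
        simp only [res] at h2
        linarith
      · have h1 := hn ⟨i, h⟩
        have h2 := hl ⟨i, h⟩
        simp only at h1 h2
        rw [div_le_iff_of_neg h1] at h2
        simp only [res] at h2
        linarith

/-- polynomial bound on linear functional (with polynomial coefficients) over bounded polyhedra -/
lemma bound_above (n m : ℕ) (c : Fin n → ℤ[X]) (A : Fin m → Fin n → ℤ[X]) (b : Fin m → ℤ[X])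
    (hbdd : ∀ t : ℕ, 0 < t → ∃ B : ℝ, ∀ x : Fin n → ℝ,
      (∀ i, ∑ j, rv (A i j) t * x j ≤ rv (b i) t) → ∑ j, rv (c j) t * x j ≤ B) :
    ∃ K N : ℕ, ∀ K', K ≤ K' → ∀ t : ℕ, N ≤ t → ∀ x : Fin n → ℝ,
      (∀ i, ∑ j, rv (A i j) t * x j ≤ rv (b i) t) → ∑ j, rv (c j) t * x j ≤ (t : ℝ) ^ K' := by
  obtain ⟨κ, _, q', b', N, H⟩ := fm n (Fin m ⊕ Bool)
    (Sum.elim A (fun e j => if e then c j else - c j))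
    (Sum.elim (fun _ => 0) (fun e => if e then -1 else 1)) (Sum.elim b (fun _ => 0))
  have H' : ∀ t : ℕ, N ≤ t → ∀ y : ℝ,
      (∃ x : Fin n → ℝ, (∀ i, ∑ j, rv (A i j) t * x j ≤ rv (b i) t) ∧ ∑ j, rv (c j) t * x j = y) ↔
      ∀ k, rv (q' k) t * y ≤ rv (b' k) t := by
    intro t ht y
    rw [← H t ht y]
    refine exists_congr fun x => ?_
    simp only [Sum.forall, Sum.elim_inl, Sum.elim_inr, Bool.forall_bool]
    refine and_congr (by simp [rv]) ?_
    simp only [rv, Bool.false_eq_true, if_false, if_true, eval_neg, eval_one, eval_zero,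
      Int.cast_neg, Int.cast_one, Int.cast_zero, neg_mul, Finset.sum_neg_distrib]
    constructor
    · intro h; constructor <;> linarith
    · rintro ⟨h1, h2⟩; linarith
  choose Ns hs using fun k => poly_sign (q' k)
  choose Ks Nb hb using fun k => poly_bound (b' k)
  obtain ⟨N1, hN1⟩ : ∃ N1, ∀ i, Ns i ≤ N1 := (Set.finite_range Ns).bddAbove.imp
    fun N h i => h ⟨i, rfl⟩
  obtain ⟨N2, hN2⟩ : ∃ N1, ∀ i, Nb i ≤ N1 := (Set.finite_range Nb).bddAbove.imp
    fun N h i => h ⟨i, rfl⟩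
  obtain ⟨K, hK⟩ : ∃ N1, ∀ i, Ks i ≤ N1 := (Set.finite_range Ks).bddAbove.imp
    fun N h i => h ⟨i, rfl⟩
  refine ⟨K, N + N1 + N2 + 1, fun K' hK' t ht x hx => ?_⟩
  have hy := (H' t (by omega) _).1 ⟨x, hx, rfl⟩
  set y := ∑ j, rv (c j) t * x j with hydef
  by_cases hc : ∃ k, ∀ t : ℕ, Ns k ≤ t → 0 < (q' k).eval (t : ℤ)
  · obtain ⟨k, hk⟩ := hc
    have h1 : (1 : ℝ) ≤ rv (q' k) t := by
      have h : 0 < (q' k).eval (t : ℤ) := hk t (by have := hN1 k; omega)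
      simp only [rv]
      exact_mod_cast h
    have h2 : rv (b' k) t ≤ (t : ℝ) ^ K' := by
      have h := hb k K' ((hK k).trans hK') t (by have := hN2 k; omega)
      have h := (le_abs_self _).trans h
      simp only [rv]
      exact_mod_cast h
    have h3 := hy k
    have h4 : (0 : ℝ) ≤ (t : ℝ) ^ K' := by positivity
    by_contra hcon
    push Not at hcon
    nlinarith
  · exfalso
    obtain ⟨B, hB⟩ := hbdd t (by omega)
    have hle : ∀ k, rv (q' k) t ≤ 0 := by
      intro k
      have hk := hN1 k
      rcases hs k with h | h | h
      · simp [rv, h t (by omega)]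
      · exact (hc ⟨k, h⟩).elim
      · have := (h t (by omega)).le
        simp only [rv]; exact_mod_cast this
    obtain ⟨x', hx', hxy⟩ := (H' t (by omega) (max y (B + 1))).2 (fun k => by
      have h1 := hy k
      have h2 := hle k
      have h3 := le_max_left y (B + 1)
      nlinarith)
    have h1 := hB x' hx'
    have h2 := le_max_right y (B + 1)
    linarith

end KthEQP


namespace KthEQP
open Polynomial

lemma bound_abs (n m : ℕ) (c : Fin n → ℤ[X]) (A : Fin m → Fin n → ℤ[X]) (b : Fin m → ℤ[X])
    (hbdd : ∀ t : ℕ, 0 < t → Bornology.IsBounded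
      {x : Fin n → ℝ | ∀ i, ∑ j, rv (A i j) t * x j ≤ rv (b i) t}) :
    ∃ K N : ℕ, ∀ K', K ≤ K' → ∀ t : ℕ, N ≤ t → ∀ x : Fin n → ℤ,
      (∀ i, ∑ j, (A i j).eval (t : ℤ) * x j ≤ (b i).eval (t : ℤ)) →
        |∑ j, (c j).eval (t : ℤ) * x j| ≤ (t : ℤ) ^ K' := by
  have aux : ∀ c : Fin n → ℤ[X], ∀ t : ℕ, 0 < t → ∃ B : ℝ, ∀ x : Fin n → ℝ,
      (∀ i, ∑ j, rv (A i j) t * x j ≤ rv (b i) t) → ∑ j, rv (c j) t * x j ≤ B := by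
    intro c t ht
    obtain ⟨R, hR⟩ := (hbdd t ht).exists_norm_le
    refine ⟨∑ j, |rv (c j) t| * R, fun x hx => Finset.sum_le_sum fun j _ => ?_⟩
    have h1 : |x j| ≤ R := (norm_le_pi_norm x j).trans (hR x hx)
    calc rv (c j) t * x j ≤ |rv (c j) t * x j| := le_abs_self _
      _ = |rv (c j) t| * |x j| := abs_mul _ _
      _ ≤ _ := mul_le_mul_of_nonneg_left h1 (abs_nonneg _)
  obtain ⟨K1, N1, H1⟩ := bound_above n m c A b (aux c)
  obtain ⟨K2, N2, H2⟩ := bound_above n m (fun j => - c j) A b (aux _)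
  refine ⟨max K1 K2, max N1 N2, fun K' hK' t ht x hx => ?_⟩
  have hx' : ∀ i, ∑ j, rv (A i j) t * ((x j : ℤ) : ℝ) ≤ rv (b i) t := by
    intro i
    simp only [rv]
    exact_mod_cast hx i
  have h1 := H1 K' ((le_max_left _ _).trans hK') t ((le_max_left _ _).trans ht) _ hx'
  have h2 := H2 K' ((le_max_right _ _).trans hK') t ((le_max_right _ _).trans ht) _ hx'
  simp only [rv, eval_neg, Int.cast_neg, neg_mul, Finset.sum_neg_distrib] at h1 h2
  have h1' : ∑ j, (c j).eval (t : ℤ) * x j ≤ (t : ℤ) ^ K' := by exact_mod_cast h1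
  have h2' : -∑ j, (c j).eval (t : ℤ) * x j ≤ (t : ℤ) ^ K' := by exact_mod_cast h2
  rw [abs_le]
  constructor <;> linarith

lemma bound_all (n m : ℕ) (c : Fin n → ℤ[X]) (A : Fin m → Fin n → ℤ[X]) (b : Fin m → ℤ[X])
    (hbdd : ∀ t : ℕ, 0 < t → Bornology.IsBounded
      {x : Fin n → ℝ | ∀ i, ∑ j, rv (A i j) t * x j ≤ rv (b i) t}) :
    ∃ K N : ℕ, ∀ t : ℕ, N ≤ t → ∀ x : Fin n → ℤ,
      (∀ i, ∑ j, (A i j).eval (t : ℤ) * x j ≤ (b i).eval (t : ℤ)) →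
        (∀ j, |x j| ≤ (t : ℤ) ^ K) ∧ |∑ j, (c j).eval (t : ℤ) * x j| ≤ (t : ℤ) ^ K := by
  classical
  obtain ⟨K0, N0, H0⟩ := bound_abs n m c A b hbdd
  choose Ks Ns Hs using fun j : Fin n => bound_abs n m (fun j' => if j' = j then 1 else 0) A b hbdd
  obtain ⟨N1, hN1⟩ : ∃ N1, ∀ i, Ns i ≤ N1 := (Set.finite_range Ns).bddAbove.imp
    fun N h i => h ⟨i, rfl⟩
  obtain ⟨K1, hK1⟩ : ∃ N1, ∀ i, Ks i ≤ N1 := (Set.finite_range Ks).bddAbove.imp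
    fun N h i => h ⟨i, rfl⟩
  refine ⟨max K0 K1, max N0 N1, fun t ht x hx => ⟨fun j => ?_, ?_⟩⟩
  · have := Hs j (max K0 K1) ((hK1 j).trans (le_max_right _ _)) t
      ((hN1 j).trans ((le_max_right _ _).trans ht)) x hx
    simpa [apply_ite] using this
  · exact H0 _ (le_max_left _ _) t ((le_max_left _ _).trans ht) x hx

lemma Good.congr {K : ℕ} {β : Type} {P Q : ℕ → (β → ℤ) → Prop} (h : Good K P)
    (e : ∀ t x, Q t x ↔ P t x) : Good K Q := by
  have : Q = P := by funext t x; exact propext (e t x)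
  rw [this]; exact h

lemma Good.le {K : ℕ} {β : Type} [Finite β] (a b : β) :
    Good K (fun _ (x : β → ℤ) => x a ≤ x b) := by
  refine ((Good.lin (K := K) (![1, -1] : Fin 2 → ℤ[X]) 0).comap ![a, b]).congr fun t x => ?_
  simp

section Main

variable {n m : ℕ} (c : Fin n → ℤ[X]) (A : Fin m → Fin n → ℤ[X]) (b : Fin m → ℤ[X]) (l K : ℕ)

def PP (t : ℕ) (y : Unit ⊕ (Fin l × Fin n) → ℤ) : Prop :=
  (∀ i r, ∑ j, (A r j).eval (t : ℤ) * y (Sum.inr (i, j)) ≤ (b r).eval (t : ℤ)) ∧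
  (∀ i, y (Sum.inl ()) ≤ ∑ j, (c j).eval (t : ℤ) * y (Sum.inr (i, j))) ∧
  ∀ i i', i ≠ i' → ∃ j, ¬ (y (Sum.inr (i, j)) ≤ y (Sum.inr (i', j)) ∧
    y (Sum.inr (i', j)) ≤ y (Sum.inr (i, j)))

def WW (t : ℕ) (x : Unit → ℤ) : Prop :=
  ∃ y : Fin l × Fin n → ℤ, (∀ c, Rng K t (y c)) ∧ PP c A b l t (Sum.elim x y)

def QQ (t : ℕ) (x : Unit → ℤ) : Prop :=
  WW c A b l K t x ∧ ¬ ∃ y : Unit → ℤ, (∀ c, Rng K t (y c)) ∧ (WW c A b l K t y ∧ ¬ (y () ≤ x ()))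

lemma good_PP : Good K (PP c A b l) := by
  refine .and ?_ (.and ?_ ?_)
  · exact .all fun i => .all fun r => (Good.lin (A r) (b r)).comap fun j => Sum.inr (i, j)
  · refine .all fun i => ?_
    refine ((Good.lin (K := K) (β := Unit ⊕ Fin n) (Sum.elim (fun _ => 1) (fun j => - c j)) 0).comap
      (Sum.elim (fun _ => Sum.inl ()) (fun j => Sum.inr (i, j)))).congr fun t x => ?_
    simp
  · exact .all fun i => .all fun i' => .imp_const _ <| .exi fun j => ((Good.le _ _).and
      (Good.le _ _)).not

lemma good_WW : Good K (WW c A b l K) := (good_PP c A b l K).proj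

lemma good_QQ : Good K (QQ c A b l K) := by
  refine (good_WW c A b l K).and (Good.not ?_)
  have h1 : Good K (fun t (x : Unit ⊕ Unit → ℤ) => WW c A b l K t (fun u => x (Sum.inr u)) ∧
      ¬ (x (Sum.inr ()) ≤ x (Sum.inl ()))) :=
    ((good_WW c A b l K).comap Sum.inr).and (Good.le _ _).not
  exact h1.proj

end Main

end KthEQP

open KthEQP
theorem kth_largest_objective_eqp (n m : ℕ) (hn : 0 < n) (hm : 0 < m)
    (c : Fin n → Polynomial ℤ)
    (A : Matrix (Fin m) (Fin n) (Polynomial ℤ)) (b : Fin m → Polynomial ℤ)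
    (hbdd : ∀ t : ℕ, 0 < t → Bornology.IsBounded
      {x : Fin n → ℝ | ∀ i, ∑ j, (evalAt (A i j) t : ℝ) * x j ≤ (evalAt (b i) t : ℝ)})
    (ℓ : ℕ) (hl : 0 < ℓ) (f : ℕ → WithBot ℤ)
    (hf : ∀ t : ℕ, 0 < t → IsKthLargest
      {x : Fin n → ℤ | ∀ i, ∑ j, evalAt (A i j) t * x j ≤ evalAt (b i) t}
      (fun x => ∑ j, evalAt (c j) t * x j) ℓ (f t)) :
    IsEQPBot f := by
  classical
  obtain ⟨K, N, hKN⟩ := bound_all n m c A b hbdd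
  -- the feasible set is finite
  have hfin : ∀ t : ℕ, N ≤ t →
      {x : Fin n → ℤ | ∀ i, ∑ j, evalAt (A i j) t * x j ≤ evalAt (b i) t}.Finite := by
    intro t ht
    refine (Set.Finite.pi' (t := fun _ : Fin n => Set.Icc (-(t : ℤ) ^ K) ((t : ℤ) ^ K))
      fun _ => Set.finite_Icc _ _).subset fun x hx j => ?_
    exact abs_le.1 ((hKN t ht x hx).1 j)
  have hW1 : ∀ t : ℕ, N ≤ t → ∀ w : ℤ, WW c A b ℓ K t (fun _ => w) →
      ℓ ≤ {x ∈ {x : Fin n → ℤ | ∀ i, ∑ j, evalAt (A i j) t * x j ≤ evalAt (b i) t} |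
        w ≤ ∑ j, evalAt (c j) t * x j}.ncard := by
    rintro t ht w ⟨y, -, h1, h2, h3⟩
    let g : Fin ℓ → Fin n → ℤ := fun i j => y (i, j)
    have hg : Function.Injective g := by
      intro i i' hii
      by_contra hne
      obtain ⟨j, hj⟩ := h3 i i' hne
      apply hj
      have : y (i, j) = y (i', j) := congrFun hii j
      simp [this]
    have hcard : (Set.range g).ncard = ℓ := by
      rw [← Set.image_univ, Set.ncard_image_of_injective _ hg, Set.ncard_univ, Nat.card_fin]
    rw [← hcard]
    refine Set.ncard_le_ncard ?_ ((hfin t ht).subset (Set.sep_subset _ _))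
    rintro _ ⟨i, rfl⟩
    exact ⟨fun r => h1 i r, h2 i⟩
  have hW2 : ∀ t : ℕ, N ≤ t → 2 ≤ t → ∀ w : ℤ,
      ℓ ≤ {x ∈ {x : Fin n → ℤ | ∀ i, ∑ j, evalAt (A i j) t * x j ≤ evalAt (b i) t} |
        w ≤ ∑ j, evalAt (c j) t * x j}.ncard → WW c A b ℓ K t (fun _ => w) := by
    intro t ht ht2 w hw
    obtain ⟨s, hs, hsc⟩ := Set.exists_subset_card_eq hw
    have hsf : s.Finite := ((hfin t ht).subset (Set.sep_subset _ _)).subset hs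
    have : Fintype s := hsf.fintype
    have hc : Fintype.card s = ℓ := by rw [← hsc, Set.ncard_eq_toFinset_card', Set.toFinset_card]
    let e := (Fintype.equivFinOfCardEq hc).symm
    refine ⟨fun p => (e p.1).1 p.2, fun p => ?_, fun i r => ?_, fun i => ?_, fun i i' hne => ?_⟩
    · exact rng_of_abs_le ht2 ((hKN t ht _ (hs (e p.1).2).1).1 _)
    · exact (hs (e i).2).1 r
    · exact (hs (e i).2).2
    · by_contra hcon
      push Not at hcon
      apply hne
      apply e.injective
      apply Subtype.ext
      funext j
      by_contra hj
      have hjj : ¬ ((e i).1 j ≤ (e i').1 j ∧ (e i').1 j ≤ (e i).1 j) :=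
        fun h => hj (le_antisymm h.1 h.2)
      exact hjj (hcon j)
  refine good_eqp (good_QQ c A b ℓ K) ?_ f (N + 2) ?_ ?_
  · rintro t x y hx hy ⟨hwx, hmx⟩ ⟨hwy, hmy⟩
    funext u
    apply le_antisymm
    · by_contra h
      exact hmy ⟨x, fun _ => hx, hwx, h⟩
    · by_contra h
      exact hmx ⟨y, fun _ => hy, hwy, h⟩
  · intro t ht z hz
    rcases hf t (by omega) with ⟨-, hbot⟩ | ⟨-, z', hz', hlt, hge⟩
    · rw [hz] at hbot; exact (WithBot.coe_ne_bot hbot).elim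
    · have hzz : z = z' := WithBot.coe_injective (hz.symm.trans hz')
      subst hzz
      refine ⟨⟨hW2 t (by omega) (by omega) z hge, ?_⟩, ?_⟩
      · rintro ⟨y, -, hy, hyz⟩
        have h1 := hW1 t (by omega) (y ()) hy
        have h2 := Set.ncard_le_ncard (s := {x ∈ {x : Fin n → ℤ | ∀ i, ∑ j, evalAt (A i j) t * x j
          ≤ evalAt (b i) t} | y () ≤ ∑ j, evalAt (c j) t * x j})
          (t := {x ∈ {x : Fin n → ℤ | ∀ i, ∑ j, evalAt (A i j) t * x j
          ≤ evalAt (b i) t} | z < ∑ j, evalAt (c j) t * x j})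
          (fun x hx => ⟨hx.1, lt_of_lt_of_le (not_le.1 hyz) hx.2⟩)
          ((hfin t (by omega)).subset (Set.sep_subset _ _))
        exact absurd (h1.trans h2) (not_le.2 hlt)
      · -- `z` is attained
        obtain ⟨x, hx, hxn⟩ := Set.exists_mem_notMem_of_ncard_lt_ncard (lt_of_lt_of_le hlt hge)
          ((hfin t (by omega)).subset (Set.sep_subset _ _))
        have hxz : z = ∑ j, evalAt (c j) t * x j := by
          apply le_antisymm hx.2
          by_contra h
          exact hxn ⟨hx.1, not_le.1 h⟩
        rw [hxz]
        exact rng_of_abs_le (by omega) (hKN t (by omega) x hx.1).2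
  · rintro t ht hbot z ⟨hw, -⟩
    rcases hf t (by omega) with ⟨hlt, -⟩ | ⟨-, z', hz', -, -⟩
    · have h1 := hW1 t (by omega) z hw
      have h2 := Set.ncard_le_ncard (Set.sep_subset
        {x : Fin n → ℤ | ∀ i, ∑ j, evalAt (A i j) t * x j ≤ evalAt (b i) t}
        (fun x => z ≤ ∑ j, evalAt (c j) t * x j)) (hfin t (by omega))
      exact absurd (h1.trans h2) (not_le.2 hlt)
    · rw [hbot] at hz'; exact (WithBot.coe_ne_bot hz'.symm).elim
end

section
/- Let m, n_1, n_2, p_1, p_2 be positive integers, c a vector of n_2 polynomials with integer coefficients, A_1 a p_1 × (n_1+n_2) matrix of such polynomials, A_2 a p_2 × n_2 matrix of such polynomials, b_1 a vector of p_1 such polynomials, and b_2 a vector of p_2 such polynomials. For each positive integer t set R_1(t) = {x ∈ ℝ^{n_1+n_2} : x ≥ 0 and A_1(t)x = b_1(t)} and R_2(t) = {x ∈ ℝ^{n_2} : x ≥ 0 and A_2(t)x ≤ b_2(t)}, and assume both are bounded for every positive integer t. Let L_1(t) and L_2(t) be the sets of integer points of R_1(t) and R_2(t), and let L_3(t) =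 {x₂ ∈ L_2(t) : the number of x₃ ∈ ℤ^{n_1} with (x₂, x₃) ∈ L_1(t) is less than m}, where (x₂, x₃) denotes the concatenated vector with x₂ in the first n_2 coordinates. For each positive integer ℓ, let f_ℓ(t) be the ℓ-th largest value with multiplicity of c(t)·x₂ over x₂ ∈ L_3(t), or −∞ if |L_3(t)| < ℓ. Then for every ℓ, f_ℓ is eventually quasi-polynomial. -/
/-- Lattice points of `R₁(t) = {x ≥ 0 : A₁(t) x = b₁(t)}`; coordinates are indexed by
`Fin n₂ ⊕ Fin n₁`, with the `Fin n₂` block the first `n₂` coordinates. -/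
def latticeL1 {n1 n2 p1 : ℕ} (A1 : Matrix (Fin p1) (Fin n2 ⊕ Fin n1) (Polynomial ℤ))
    (b1 : Fin p1 → Polynomial ℤ) (t : ℕ) : Set ((Fin n2 ⊕ Fin n1) → ℤ) :=
  {x | (∀ j, 0 ≤ x j) ∧ ∀ i, ∑ j, evalAt (A1 i j) t * x j = evalAt (b1 i) t}

/-- Lattice points of `R₂(t) = {x ≥ 0 : A₂(t) x ≤ b₂(t)}`. -/
def latticeL2 {n2 p2 : ℕ} (A2 : Matrix (Fin p2) (Fin n2) (Polynomial ℤ))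
    (b2 : Fin p2 → Polynomial ℤ) (t : ℕ) : Set (Fin n2 → ℤ) :=
  {x | (∀ j, 0 ≤ x j) ∧ ∀ i, ∑ j, evalAt (A2 i j) t * x j ≤ evalAt (b2 i) t}

/-- `L₃(t)`: the points of `L₂(t)` which are the projection of fewer than `m` points
of `L₁(t)`. -/
noncomputable def latticeL3 {n1 n2 p1 p2 : ℕ} (m : ℕ)
    (A1 : Matrix (Fin p1) (Fin n2 ⊕ Fin n1) (Polynomial ℤ)) (b1 : Fin p1 → Polynomial ℤ)
    (A2 : Matrix (Fin p2) (Fin n2) (Polynomial ℤ)) (b2 : Fin p2 → Polynomial ℤ)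
    (t : ℕ) : Set (Fin n2 → ℤ) :=
  {x2 ∈ latticeL2 A2 b2 t |
    {x3 : Fin n1 → ℤ | Sum.elim x2 x3 ∈ latticeL1 A1 b1 t}.ncard < m}

section Presb
open FirstOrder Language

/-- Presburger definability of a relation between a parameter `t` and a vector `u`. -/
def Pres {β : Type} (R : ℕ → (β → ℕ) → Prop) : Prop :=
  (∅ : Set ℕ).Definable presburger {v : Option β → ℕ | R (v none) (fun i => v (some i))}

variable {β γ : Type}

theorem Pres.congr {R S : ℕ → (β → ℕ) → Prop} (h : Pres R) (hRS : ∀ t u, S t u ↔ R t u) :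
    Pres S := by
  have : S = R := by
    funext t u; exact propext (hRS t u)
  rw [this]; exact h

theorem Pres.and {R S : ℕ → (β → ℕ) → Prop} (h : Pres R) (h' : Pres S) :
    Pres (fun t u => R t u ∧ S t u) := Set.Definable.inter h h'

theorem Pres.or {R S : ℕ → (β → ℕ) → Prop} (h : Pres R) (h' : Pres S) :
    Pres (fun t u => R t u ∨ S t u) := Set.Definable.union h h'

theorem Pres.not {R : ℕ → (β → ℕ) → Prop} (h : Pres R) :
    Pres (fun t u => ¬ R t u) := Set.Definable.compl h

theorem Pres.all {ι : Type} [Finite ι] {R : ι → ℕ → (β → ℕ) → Prop} (h : ∀ i, Pres (R i)) :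
    Pres (fun t u => ∀ i, R i t u) := by
  have := Set.definable_iInter_of_finite h
  unfold Pres
  convert! this using 1
  ext v; simp

theorem Pres.ex {ι : Type} [Finite ι] {R : ι → ℕ → (β → ℕ) → Prop} (h : ∀ i, Pres (R i)) :
    Pres (fun t u => ∃ i, R i t u) := by
  have := Set.definable_iUnion_of_finite h
  unfold Pres
  convert! this using 1
  ext v; simp

theorem Pres.comp {R : ℕ → (β → ℕ) → Prop} (h : Pres R) (f : β → γ) :
    Pres (fun t (u : γ → ℕ) => R t (fun i => u (f i))) := by
  have := Set.Definable.preimage_comp (Option.map f) h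
  exact this

theorem Pres.exists [Finite γ] {R : ℕ → (β ⊕ γ → ℕ) → Prop} (h : Pres R) :
    Pres (fun t (u : β → ℕ) => ∃ w : γ → ℕ, R t (Sum.elim u w)) := by
  have h1 := Set.Definable.preimage_comp (β := Option β ⊕ γ)
    (fun o : Option (β ⊕ γ) => match o with
      | none => Sum.inl none
      | some (Sum.inl i) => Sum.inl (some i)
      | some (Sum.inr i) => Sum.inr i) h
  have h2 := h1.exists_of_finite
  unfold Pres
  convert! h2 using 1
  ext v
  simp only [Set.mem_ofPred_eq, Set.mem_preimage]
  refine exists_congr fun w => ?_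
  have : (Sum.elim (fun i => v (some i)) w : β ⊕ γ → ℕ) = fun i => (Sum.elim v w ∘ (fun o : Option (β ⊕ γ) => match o with
      | none => Sum.inl none
      | some (Sum.inl i) => Sum.inl (some i)
      | some (Sum.inr i) => Sum.inr i)) (some i) := by
    funext i; rcases i with i | i <;> rfl
  rw [this]; rfl

/-- Affine integer functions of `(t, u)`. -/
def Aff [Fintype β] (g : ℕ → (β → ℕ) → ℤ) : Prop :=
  ∃ (k e : ℤ) (a : β → ℤ), ∀ t u, g t u = k + e * t + ∑ i, a i * (u i : ℤ)

theorem Aff.nonneg [Fintype β] {g : ℕ → (β → ℕ) → ℤ} (h : Aff g) :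
    Pres (fun t u => 0 ≤ g t u) := by
  obtain ⟨k, e, a, h⟩ := h
  -- positive and negative parts
  let A : Option β → ℕ := fun o => o.elim e.toNat (fun i => (a i).toNat)
  let B : Option β → ℕ := fun o => o.elim (-e).toNat (fun i => (-(a i)).toNat)
  have h1 := Nat.isSemilinearSet_setOfPred_mulVec_eq (ι := Fin 1) (κ := Option β ⊕ Fin 1) ![k.toNat] ![(-k).toNat]
    (.of ![Sum.elim A 0]) (.of ![Sum.elim B 1])
  have h2 := h1.proj
  unfold Pres
  rw [presburger.definable_iff_isSemilinearSet]
  convert! h2 using 1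
  ext v
  simp only [Set.mem_ofPred_eq, h, A, B]
  have key : ∀ z : ℤ, ((z.toNat : ℤ) - ((-z).toNat : ℤ)) = z := by intro z; omega
  have e1 : k + e * (v none) + ∑ i, a i * (v (some i) : ℤ) =
      ((k.toNat + (e.toNat * v none + ∑ i, (a i).toNat * v (some i)) : ℕ) : ℤ)
      - (((-k).toNat + ((-e).toNat * v none + ∑ i, (-(a i)).toNat * v (some i)) : ℕ) : ℤ) := by
    push_cast
    have : ∑ i, a i * (v (some i) : ℤ) = ∑ i, ((a i).toNat : ℤ) * (v (some i) : ℤ)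
        - ∑ i, ((-(a i)).toNat : ℤ) * (v (some i) : ℤ) := by
      rw [← Finset.sum_sub_distrib]
      refine Finset.sum_congr rfl fun i _ => ?_
      rw [← sub_mul, key]
    rw [this]
    nth_rw 1 [← key k, ← key e]
    ring
  rw [e1]
  generalize hP : (k.toNat + (e.toNat * v none + ∑ i, (a i).toNat * v (some i)) : ℕ) = P
  generalize hQ : ((-k).toNat + ((-e).toNat * v none + ∑ i, (-(a i)).toNat * v (some i)) : ℕ) = Q
  have : (0 ≤ (P : ℤ) - Q) ↔ ∃ s : ℕ, P = Q + s := by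
    constructor
    · intro h; exact ⟨P - Q, by omega⟩
    · rintro ⟨s, rfl⟩; push_cast; omega
  rw [this]
  constructor
  · rintro ⟨s, hs⟩
    refine ⟨fun _ => s, ?_⟩
    simp [dotProduct, Fintype.sum_option]
    omega
  · rintro ⟨s, hs⟩
    refine ⟨s 0, ?_⟩
    simp [dotProduct, Fintype.sum_option] at hs
    omega

end Presb

section Horner
open FirstOrder Language
variable {β γ : Type}

theorem Aff.const [Fintype β] (k : ℤ) : Aff (fun _ (_ : β → ℕ) => k) :=
  ⟨k, 0, 0, by intros; simp⟩

theorem Aff.param [Fintype β] : Aff (fun t (_ : β → ℕ) => (t : ℤ)) :=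
  ⟨0, 1, 0, by intros; simp⟩

theorem Aff.var [Fintype β] (i : β) : Aff (fun _ (u : β → ℕ) => (u i : ℤ)) := by
  classical
  exact ⟨0, 0, Pi.single i 1, by intros; simp [Pi.single_apply]⟩

theorem Aff.add [Fintype β] {g h : ℕ → (β → ℕ) → ℤ} (hg : Aff g) (hh : Aff h) :
    Aff (fun t u => g t u + h t u) := by
  obtain ⟨k, e, a, hg⟩ := hg
  obtain ⟨k', e', a', hh⟩ := hh
  refine ⟨k + k', e + e', a + a', fun t u => ?_⟩
  simp only [hg, hh, Pi.add_apply, add_mul, Finset.sum_add_distrib]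
  ring

theorem Aff.smul [Fintype β] {g : ℕ → (β → ℕ) → ℤ} (hg : Aff g) (c : ℤ) :
    Aff (fun t u => c * g t u) := by
  obtain ⟨k, e, a, hg⟩ := hg
  refine ⟨c * k, c * e, fun i => c * a i, fun t u => ?_⟩
  simp only [hg, mul_add, Finset.mul_sum, mul_assoc]

/-- All digits are `< t`. -/
def Dig (t : ℕ) (u : β → ℕ) : Prop := 1 ≤ t ∧ ∀ i, u i < t

theorem Aff.nonneg' [Fintype β] {g h : ℕ → (β → ℕ) → ℤ} (hg : Aff g) (hh : Aff h) :
    Pres (fun t u => g t u ≤ h t u) := by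
  refine (hh.add (hg.smul (-1))).nonneg.congr fun t u => ?_
  constructor <;> intro h <;> linarith

theorem pres_dig [Fintype β] : Pres (Dig (β := β)) := by
  refine Pres.and (S := fun t u => ∀ i : β, u i < t) ?_ (Pres.all fun i => ?_)
  · exact ((Aff.const 1).nonneg' Aff.param).congr fun t u => by simp
  · exact (((Aff.var i).add (Aff.const 1)).nonneg' Aff.param).congr fun t u => by omega

theorem Aff.bound [Fintype β] {g : ℕ → (β → ℕ) → ℤ} (hg : Aff g) :
    ∃ C : ℕ, ∀ t u, Dig t u → |g t u| ≤ C * t := by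
  obtain ⟨k, e, a, hg⟩ := hg
  refine ⟨k.natAbs + e.natAbs + ∑ i, (a i).natAbs, fun t u ⟨ht, hu⟩ => ?_⟩
  rw [hg]
  push_cast
  have ht' : (1 : ℤ) ≤ t := by exact_mod_cast ht
  calc |k + e * t + ∑ i, a i * (u i : ℤ)| ≤ |k| + |e * t| + |∑ i, a i * (u i : ℤ)| := by
        exact (abs_add_le _ _).trans (add_le_add (abs_add_le _ _) le_rfl)
    _ ≤ |k| * t + |e| * t + ∑ i, |a i| * t := by
        refine add_le_add (add_le_add ?_ ?_) ((Finset.abs_sum_le_sum_abs _ _).trans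
          (Finset.sum_le_sum fun i _ => ?_))
        · nlinarith [abs_nonneg k]
        · rw [abs_mul, Nat.abs_cast]
        · rw [abs_mul, Nat.abs_cast]
          exact mul_le_mul_of_nonneg_left (by exact_mod_cast (hu i).le) (abs_nonneg _)
    _ = _ := by rw [← Finset.sum_mul]; ring

/-- Polynomials in `t` with coefficients affine in `u`, in Horner form. -/
inductive PA [Fintype β] : (ℕ → (β → ℕ) → ℤ) → Prop
  | aff (g : ℕ → (β → ℕ) → ℤ) (hg : Aff g) : PA g
  | step (g G : ℕ → (β → ℕ) → ℤ) (hg : Aff g) (hG : PA G) : PA (fun t u => g t u + t * G t u)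

theorem PA.congr [Fintype β] {g h : ℕ → (β → ℕ) → ℤ} (hg : PA g) (hh : ∀ t u, h t u = g t u) :
    PA h := by
  have : h = g := by funext t u; exact hh t u
  rw [this]; exact hg

theorem PA.add [Fintype β] {g h : ℕ → (β → ℕ) → ℤ} (hg : PA g) (hh : PA h) :
    PA (fun t u => g t u + h t u) := by
  induction hg generalizing h with
  | aff g hg =>
    cases hh with
    | aff h hh => exact .aff _ (hg.add hh)
    | step h H hh hH =>
      exact (PA.step _ _ (hg.add hh) hH).congr fun t u => by ring
  | step g G hg hG ih =>
    cases hh with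
    | aff h hh => exact (PA.step _ _ (hg.add hh) hG).congr fun t u => by ring
    | step h H hh hH =>
      exact (PA.step _ _ (hg.add hh) (ih hH)).congr fun t u => by ring

theorem PA.smul [Fintype β] {g : ℕ → (β → ℕ) → ℤ} (hg : PA g) (c : ℤ) :
    PA (fun t u => c * g t u) := by
  induction hg with
  | aff g hg => exact .aff _ (hg.smul c)
  | step g G hg hG ih => exact (PA.step _ _ (hg.smul c) ih).congr fun t u => by ring

theorem PA.mulT [Fintype β] {g : ℕ → (β → ℕ) → ℤ} (hg : PA g) (n : ℕ) :
    PA (fun t u => (t : ℤ) ^ n * g t u) := by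
  induction n with
  | zero => exact hg.congr fun t u => by ring
  | succ n ih => exact (PA.step _ _ (Aff.const 0) ih).congr fun t u => by ring

theorem PA.sum [Fintype β] {ι : Type} (s : Finset ι) {g : ι → ℕ → (β → ℕ) → ℤ}
    (hg : ∀ i, PA (g i)) : PA (fun t u => ∑ i ∈ s, g i t u) := by
  classical
  induction s using Finset.induction_on with
  | empty => exact (PA.aff _ (Aff.const 0)).congr fun t u => by simp
  | insert a s ha ih =>
    exact ((hg a).add ih).congr fun t u => by rw [Finset.sum_insert ha]

theorem PA.mulPoly [Fintype β] {g : ℕ → (β → ℕ) → ℤ} (hg : PA g) (p : Polynomial ℤ) :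
    PA (fun t u => evalAt p t * g t u) := by
  induction p using Polynomial.induction_on' with
  | add p q hp hq =>
    exact (hp.add hq).congr fun t u => by simp [evalAt, add_mul]
  | monomial n a =>
    exact ((hg.mulT n).smul a).congr fun t u => by simp [evalAt, mul_assoc]

theorem PA.poly [Fintype β] (p : Polynomial ℤ) : PA (fun t (_ : β → ℕ) => evalAt p t) :=
  ((PA.aff _ (Aff.const 1)).mulPoly p).congr fun t u => by simp

theorem PA.nonneg_aux [Fintype β] {G : ℕ → (β → ℕ) → ℤ} (hG : PA G) :
    ∀ e : ℤ, Pres (fun t u => Dig t u ∧ 0 ≤ e + G t u) := by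
  induction hG with
  | aff g hg => exact fun e => pres_dig.and ((Aff.const e).add hg).nonneg
  | step g G hg hG ih =>
    intro e
    have hA := (Aff.const e).add hg
    obtain ⟨C, hC⟩ := hA.bound
    have key := Pres.ex (ι := Fin (2 * C + 1)) (fun q =>
      ((Aff.param.smul ((q : ℤ) - C)).nonneg' hA).and
      (((hA.add (Aff.const 1)).nonneg' (Aff.param.smul ((q : ℤ) - C + 1))).and
        (ih ((q : ℤ) - C))))
    refine key.congr fun t u => ?_
    constructor
    · rintro ⟨hd, h⟩
      have hb := abs_le.1 (hC t u hd)
      have ht : (1 : ℤ) ≤ t := by exact_mod_cast hd.1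
      have hdiv := Int.emod_add_mul_ediv (e + g t u) t
      have h0 := Int.emod_nonneg (e + g t u) (by omega : (t : ℤ) ≠ 0)
      have h1 := Int.emod_lt_of_pos (e + g t u) (by omega : (0 : ℤ) < t)
      set q := (e + g t u) / (t : ℤ) with hq
      have hq1 : -(C : ℤ) ≤ q := by
        rw [hq]; apply Int.le_ediv_of_mul_le (by omega); linarith [hb.1]
      have hq2 : q ≤ C := by
        rw [hq]; apply Int.ediv_le_of_le_mul (by omega); linarith [hb.2]
      refine ⟨⟨(q + C).toNat, by omega⟩, ?_⟩
      have hcast : (((q + C).toNat : ℕ) : ℤ) - C = q := by omega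
      simp only [hcast]
      refine ⟨by nlinarith, by nlinarith, hd, ?_⟩
      by_contra hneg
      have : q + G t u ≤ -1 := by omega
      nlinarith
    · rintro ⟨q, h1, h2, hd, h3⟩
      refine ⟨hd, ?_⟩
      have ht : (1 : ℤ) ≤ t := by exact_mod_cast hd.1
      nlinarith

theorem PA.le [Fintype β] {G H : ℕ → (β → ℕ) → ℤ} (hG : PA G) (hH : PA H) :
    Pres (fun t u => Dig t u ∧ G t u ≤ H t u) := by
  refine ((hH.add (hG.smul (-1))).nonneg_aux 0).congr fun t u => and_congr_right fun _ => ?_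
  constructor <;> intro h <;> linarith

theorem PA.lt [Fintype β] {G H : ℕ → (β → ℕ) → ℤ} (hG : PA G) (hH : PA H) :
    Pres (fun t u => Dig t u ∧ G t u < H t u) := by
  refine ((hG.add (PA.aff _ (Aff.const 1))).le hH).congr fun t u => and_congr_right fun _ => ?_
  exact Int.lt_iff_add_one_le

theorem PA.eq [Fintype β] {G H : ℕ → (β → ℕ) → ℤ} (hG : PA G) (hH : PA H) :
    Pres (fun t u => Dig t u ∧ G t u = H t u) := by
  refine ((hG.le hH).and (hH.le hG)).congr fun t u => ?_
  rw [le_antisymm_iff]; tauto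

/-- Counting quantifier. -/
theorem Pres.card_ge [Finite γ] {R : ℕ → (β ⊕ γ → ℕ) → Prop} (h : Pres R)
    (hfin : ∀ t u, {w : γ → ℕ | R t (Sum.elim u w)}.Finite) (m : ℕ) :
    Pres (fun t (u : β → ℕ) => m ≤ {w : γ → ℕ | R t (Sum.elim u w)}.ncard) := by
  have := Fintype.ofFinite γ
  have h1 : ∀ i : Fin m, Pres (fun t (u : β ⊕ (Fin m × γ) → ℕ) =>
      R t (fun x => u (Sum.map id (fun g => (i, g)) x))) := fun i => h.comp _
  have h2 : ∀ i j : Fin m, Pres (fun t (u : β ⊕ (Fin m × γ) → ℕ) =>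
      i ≠ j → ∃ g, u (Sum.inr (i, g)) ≠ u (Sum.inr (j, g))) := by
    intro i j
    by_cases hij : i = j
    · have : Pres (fun t (u : Empty → ℕ) => (0 : ℤ) ≤ 0) := (Aff.const 0).nonneg
      exact (this.comp (fun x : Empty => x.elim)).congr fun t u => by simp [hij]
    · have h3 : ∀ g : γ, Pres (fun t (u : β ⊕ (Fin m × γ) → ℕ) =>
          u (Sum.inr (i, g)) ≠ u (Sum.inr (j, g))) := by
        intro g
        have h4 : Pres (fun t (u : Fin 2 → ℕ) => ¬ ((u 0 : ℤ) ≤ u 1 ∧ (u 1 : ℤ) ≤ u 0)) :=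
          (((Aff.var 0).nonneg' (Aff.var 1)).and ((Aff.var 1).nonneg' (Aff.var 0))).not
        refine (h4.comp ![Sum.inr (i, g), Sum.inr (j, g)]).congr fun t u => ?_
        simp
        omega
      exact (Pres.ex h3).congr fun t u => by simp [hij]
  have h5 := ((Pres.all h1).and (Pres.all fun i => Pres.all (h2 i))).exists
  refine h5.congr fun t u => ?_
  constructor
  · intro hm
    have : Finite {w : γ → ℕ | R t (Sum.elim u w)} := hfin t u
    have := Fintype.ofFinite {w : γ → ℕ | R t (Sum.elim u w)}
    have hc : Fintype.card (Fin m) ≤ Fintype.card {w : γ → ℕ | R t (Sum.elim u w)} := by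
      rw [Fintype.card_fin, ← Nat.card_eq_fintype_card]; exact hm
    obtain ⟨φ⟩ := Function.Embedding.nonempty_of_card_le hc
    refine ⟨fun x => (φ x.1).1 x.2, fun i => ?_, fun i j hij => ?_⟩
    · have := (φ i).2
      simp only [Set.mem_ofPred_eq] at this
      convert! this using 1
      funext x; rcases x with x | x <;> rfl
    · by_contra hcon
      push Not at hcon
      apply hij
      apply φ.injective
      apply Subtype.ext
      funext g
      exact hcon g
  · rintro ⟨W, hW1, hW2⟩
    let φ : Fin m → {w : γ → ℕ | R t (Sum.elim u w)} := fun i => ⟨fun g => W (i, g), by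
      have := hW1 i
      simp only [Set.mem_ofPred_eq]
      convert! this using 1
      funext x; rcases x with x | x <;> rfl⟩
    have hφ : Function.Injective φ := by
      intro i j hij
      by_contra hne
      obtain ⟨g, hg⟩ := hW2 i j hne
      exact hg (congrFun (congrArg Subtype.val hij) g)
    have : Finite {w : γ → ℕ | R t (Sum.elim u w)} := hfin t u
    have := Nat.card_le_card_of_injective φ hφ
    rw [Nat.card_fin] at this
    exact this

end Horner

section Select
open FirstOrder Language
open scoped Pointwise
variable {β : Type}

/-- Eventually quasi-linear selection with period `d`. -/
def Sel (d : ℕ) (s : Set (Option β → ℕ)) : Prop :=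
  ∀ r : ℕ, r < d →
    (∃ a b : β → ℚ, ∃ N : ℕ, ∀ t : ℕ, N ≤ t → t % d = r →
      ∃ v ∈ s, v none = t ∧ ∀ i, (v (some i) : ℚ) = a i + b i * t) ∨
    (∃ N : ℕ, ∀ t : ℕ, N ≤ t → t % d = r → ∀ v ∈ s, v none ≠ t)

theorem Sel.mul {d : ℕ} {s : Set (Option β → ℕ)} (h : Sel d s) (hd : 0 < d) (e : ℕ) :
    Sel (d * e) s := by
  intro r hr
  have hmod : ∀ t, t % (d * e) = r → t % d = r % d := by
    intro t ht; rw [← ht, Nat.mod_mul_right_mod]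
  rcases h (r % d) (Nat.mod_lt _ hd) with ⟨a, b, N, h⟩ | ⟨N, h⟩
  · exact Or.inl ⟨a, b, N, fun t ht htr => h t ht (hmod t htr)⟩
  · exact Or.inr ⟨N, fun t ht htr => h t ht (hmod t htr)⟩

theorem Sel.union {d : ℕ} {s s' : Set (Option β → ℕ)} (h : Sel d s) (h' : Sel d s') :
    Sel d (s ∪ s') := by
  intro r hr
  rcases h r hr with ⟨a, b, N, h⟩ | ⟨N, h⟩
  · left
    refine ⟨a, b, N, fun t ht htr => ?_⟩
    obtain ⟨v, hv, hv'⟩ := h t ht htr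
    exact ⟨v, Or.inl hv, hv'⟩
  · rcases h' r hr with ⟨a, b, N', h'⟩ | ⟨N', h'⟩
    · left
      refine ⟨a, b, N', fun t ht htr => ?_⟩
      obtain ⟨v, hv, hv'⟩ := h' t ht htr
      exact ⟨v, Or.inr hv, hv'⟩
    · right
      refine ⟨max N N', fun t ht htr v hv => ?_⟩
      rcases hv with hv | hv
      · exact h t (le_of_max_le_left ht) htr v hv
      · exact h' t (le_of_max_le_right ht) htr v hv

theorem sel_linear {s : Set (Option β → ℕ)} (hs : IsLinearSet s) : ∃ d, 0 < d ∧ Sel d s := by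
  rw [isLinearSet_iff] at hs
  obtain ⟨a, T, rfl⟩ := hs
  by_cases hT : ∃ p ∈ T, 0 < p none
  · obtain ⟨p, hp, hp0⟩ := hT
    refine ⟨p none, hp0, fun r hr => ?_⟩
    by_cases hw : ∃ w ∈ (a +ᵥ (AddSubmonoid.closure (T : Set (Option β → ℕ)) : Set (Option β → ℕ))),
        w none % p none = r
    · obtain ⟨w, hw, hwr⟩ := hw
      left
      refine ⟨fun i => w (some i) - (w none : ℚ) / p none * p (some i),
        fun i => (p (some i) : ℚ) / p none, w none, fun t ht htr => ?_⟩
      obtain ⟨k, hk⟩ : ∃ k, t = w none + k * p none := by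
        have h1 : w none ≡ t [MOD p none] := by
          unfold Nat.ModEq; rw [hwr, htr]
        obtain ⟨k, hk⟩ := (Nat.modEq_iff_dvd' ht).1 h1
        exact ⟨k, by rw [mul_comm, ← hk]; omega⟩
      refine ⟨w + k • p, ?_, ?_, fun i => ?_⟩
      · obtain ⟨y, hy, rfl⟩ := hw
        refine ⟨y + k • p, ?_, ?_⟩
        · exact add_mem hy (nsmul_mem (AddSubmonoid.subset_closure hp) k)
        · simp only [vadd_eq_add, add_assoc]
      · simp [hk]
      · have : (p none : ℚ) ≠ 0 := by exact_mod_cast hp0.ne'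
        simp only [Pi.add_apply, Pi.smul_apply, smul_eq_mul]
        rw [hk]
        push_cast
        field_simp
        ring
    · right
      refine ⟨0, fun t _ htr v hv hvt => hw ⟨v, hv, by rw [hvt, htr]⟩⟩
  · push Not at hT
    refine ⟨1, one_pos, fun r hr => Or.inr ⟨a none + 1, fun t ht _ v hv hvt => ?_⟩⟩
    obtain ⟨y, hy, rfl⟩ := hv
    have : y none = 0 := by
      clear hvt
      induction hy using AddSubmonoid.closure_induction with
      | mem x hx => have := hT x hx; omega
      | zero => rfl
      | add x y _ _ hx hy => rw [Pi.add_apply, hx, hy]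
    simp only [vadd_eq_add, Pi.add_apply] at hvt
    omega

theorem sel_semilinear {s : Set (Option β → ℕ)} (hs : IsSemilinearSet s) :
    ∃ d, 0 < d ∧ Sel d s := by
  rw [isSemilinearSet_iff] at hs
  obtain ⟨S, hS, rfl⟩ := hs
  classical
  induction S using Finset.induction_on with
  | empty => 
    refine ⟨1, one_pos, fun r hr => Or.inr ⟨0, fun t _ _ v hv => ?_⟩⟩
    simp at hv
  | insert a S ha ih =>
    obtain ⟨d, hd, h⟩ := ih (fun t ht => hS t (Finset.mem_insert_of_mem ht))
    obtain ⟨d', hd', h'⟩ := sel_linear (hS a (Finset.mem_insert_self _ _))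
    refine ⟨d * d', Nat.mul_pos hd hd', ?_⟩
    rw [Finset.coe_insert, Set.sUnion_insert]
    refine Sel.union ?_ (h.mul hd d')
    rw [mul_comm]
    exact h'.mul hd' d

end Select

section Bound

theorem exists_basic {p ι : Type} [Fintype p] [Fintype ι] (A : Matrix p ι ℝ) (b : p → ℝ)
    (hb : Bornology.IsBounded {x : ι → ℝ | (∀ j, 0 ≤ x j) ∧ A.mulVec x = b})
    (x₀ : ι → ℝ) (h0 : ∀ j, 0 ≤ x₀ j) (hA : A.mulVec x₀ = b) :
    ∃ x : ι → ℝ, (∀ j, 0 ≤ x j) ∧ A.mulVec x = b ∧ ∑ j, x₀ j ≤ ∑ j, x j ∧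
      ∀ v : ι → ℝ, (∀ j, x j = 0 → v j = 0) → A.mulVec v = 0 → v = 0 := by
  classical
  -- induction on the size of the support
  generalize hn : (Finset.univ.filter (fun j => x₀ j ≠ 0)).card = n
  induction n using Nat.strong_induction_on generalizing x₀ with
  | _ n ih =>
  by_cases hind : ∀ v : ι → ℝ, (∀ j, x₀ j = 0 → v j = 0) → A.mulVec v = 0 → v = 0
  · exact ⟨x₀, h0, hA, le_rfl, hind⟩
  obtain ⟨v, hvs, hvA, hv0, hvsum⟩ : ∃ v : ι → ℝ, (∀ j, x₀ j = 0 → v j = 0) ∧ A.mulVec v = 0 ∧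
      v ≠ 0 ∧ 0 ≤ ∑ j, v j := by
    push Not at hind
    obtain ⟨v, h1, h2, h3⟩ := hind
    rcases le_total 0 (∑ j, v j) with h | h
    · exact ⟨v, h1, h2, h3, h⟩
    · refine ⟨-v, fun j hj => by simp [h1 j hj], by rw [Matrix.mulVec_neg, h2, neg_zero],
        neg_ne_zero.2 h3, ?_⟩
      simp only [Pi.neg_apply, Finset.sum_neg_distrib]; linarith
  have hray : ∀ s : ℝ, A.mulVec (x₀ + s • v) = b := by
    intro s; rw [Matrix.mulVec_add, Matrix.mulVec_smul, hvA, smul_zero, add_zero, hA]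
  obtain ⟨j₀, hj₀⟩ : ∃ j, v j < 0 := by
    by_contra hcon
    push Not at hcon
    obtain ⟨j, hj⟩ : ∃ j, v j ≠ 0 := by
      by_contra h; push Not at h; exact hv0 (funext h)
    have hj' : 0 < v j := lt_of_le_of_ne (hcon j) hj.symm
    obtain ⟨C, hC⟩ := hb.exists_norm_le
    have hs : 0 ≤ (|C| + 1) / v j := by positivity
    have := hC (x₀ + ((|C| + 1) / v j) • v) ⟨fun i => by
      have := mul_nonneg hs (hcon i)
      simp only [Pi.add_apply, Pi.smul_apply, smul_eq_mul]; linarith [h0 i], hray _⟩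
    have h2 := (norm_le_pi_norm (x₀ + ((|C| + 1) / v j) • v) j).trans this
    simp only [Pi.add_apply, Pi.smul_apply, smul_eq_mul, Real.norm_eq_abs] at h2
    rw [div_mul_cancel₀ _ hj] at h2
    have := le_abs_self (x₀ j + (|C| + 1))
    linarith [h0 j, le_abs_self C]
  obtain ⟨i, hi, hmin⟩ := Finset.exists_min_image (Finset.univ.filter (fun j => v j < 0))
    (fun j => x₀ j / (- v j)) ⟨j₀, by simpa using hj₀⟩
  simp only [Finset.mem_filter, Finset.mem_univ, true_and] at hi hmin
  set s := x₀ i / (- v i) with hs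
  have hs0 : 0 ≤ s := div_nonneg (h0 i) (by linarith)
  have hzero : (x₀ + s • v) i = 0 := by
    simp only [Pi.add_apply, Pi.smul_apply, smul_eq_mul, hs]
    have : v i ≠ 0 := hi.ne
    field_simp; ring
  obtain ⟨x, hx1, hx2, hx3, hx4⟩ := ih _ (by
    rw [← hn]
    apply Finset.card_lt_card
    rw [Finset.ssubset_iff_of_subset]
    · refine ⟨i, ?_, ?_⟩
      · simp only [Finset.mem_filter, Finset.mem_univ, true_and]
        intro h; exact hi.ne (hvs i h)
      · simp only [Finset.mem_filter, Finset.mem_univ, true_and, not_not]; exact hzero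
    · intro j
      simp only [Finset.mem_filter, Finset.mem_univ, true_and]
      intro hj hj'
      apply hj
      simp [hj', hvs j hj']) (x₀ + s • v) (fun j => by
        simp only [Pi.add_apply, Pi.smul_apply, smul_eq_mul]
        rcases lt_or_ge (v j) 0 with hj | hj
        · have := hmin j hj
          rw [le_div_iff₀ (by linarith)] at this
          linarith
        · have := mul_nonneg hs0 hj
          linarith [h0 j]) (hray s) rfl
  refine ⟨x, hx1, hx2, le_trans ?_ hx3, hx4⟩
  simp only [Pi.add_apply, Pi.smul_apply, smul_eq_mul, Finset.sum_add_distrib, ← Finset.mul_sum]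
  have := mul_nonneg hs0 hvsum
  linarith

theorem poly_le_pow (P : Polynomial ℤ) : ∃ r N : ℕ, ∀ t : ℕ, N ≤ t → ∀ r' ≥ r,
    |evalAt P t| ≤ (t : ℤ) ^ r' := by
  refine ⟨P.natDegree + 1, 1 + ∑ i ∈ Finset.range (P.natDegree + 1), (P.coeff i).natAbs,
    fun t ht r' hr' => ?_⟩
  have h1 : 1 ≤ t := by omega
  have h1' : (1 : ℤ) ≤ t := by exact_mod_cast h1
  have h2 : (∑ i ∈ Finset.range (P.natDegree + 1), |P.coeff i|) ≤ t := by
    have : ∑ i ∈ Finset.range (P.natDegree + 1), (P.coeff i).natAbs ≤ t := by omega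
    have := (Int.ofNat_le.2 this)
    push_cast at this
    exact this
  unfold evalAt
  rw [Polynomial.eval_eq_sum_range]
  calc |∑ i ∈ Finset.range (P.natDegree + 1), P.coeff i * (t : ℤ) ^ i|
      ≤ ∑ i ∈ Finset.range (P.natDegree + 1), |P.coeff i| * (t : ℤ) ^ P.natDegree := by
        refine (Finset.abs_sum_le_sum_abs _ _).trans (Finset.sum_le_sum fun i hi => ?_)
        rw [abs_mul, abs_of_nonneg (by positivity : (0 : ℤ) ≤ (t : ℤ) ^ i)]
        refine mul_le_mul_of_nonneg_left (pow_le_pow_right₀ h1' ?_) (abs_nonneg _)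
        rw [Finset.mem_range] at hi; omega
    _ ≤ t * (t : ℤ) ^ P.natDegree := by
        rw [← Finset.sum_mul]
        exact mul_le_mul_of_nonneg_right h2 (by positivity)
    _ = (t : ℤ) ^ (P.natDegree + 1) := by ring
    _ ≤ _ := pow_le_pow_right₀ h1' hr'

theorem finite_poly_le_pow {κ : Type} [Finite κ] (P : κ → Polynomial ℤ) :
    ∃ r N : ℕ, ∀ t : ℕ, N ≤ t → ∀ k, |evalAt (P k) t| ≤ (t : ℤ) ^ r := by
  have := Fintype.ofFinite κ
  choose r N h using fun k => poly_le_pow (P k)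
  refine ⟨∑ k, r k, ∑ k, N k, fun t ht k => h k t ?_ _ ?_⟩
  · exact le_trans (Finset.single_le_sum (f := N) (fun _ _ => Nat.zero_le _) (Finset.mem_univ k)) ht
  · exact Finset.single_le_sum (f := r) (fun _ _ => Nat.zero_le _) (Finset.mem_univ k)

/-- evaluation at `t` as a ring hom to the reals -/
noncomputable def evR (t : ℕ) : Polynomial ℤ →+* ℝ :=
  (Int.castRingHom ℝ).comp (Polynomial.evalRingHom (t : ℤ))

theorem evR_apply (t : ℕ) (P : Polynomial ℤ) : evR t P = (evalAt P t : ℝ) := rfl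

theorem basic_bound {p ι : Type} [Fintype p] [Fintype ι] [DecidableEq ι]
    (A : Matrix p ι (Polynomial ℤ)) (b : p → Polynomial ℤ) (S : Finset ι) :
    ∃ P : ι → Polynomial ℤ, ∀ t : ℕ, ∀ x : ι → ℝ,
      (∀ j, j ∉ S → x j = 0) → (A.map (evR t)).mulVec x = (fun i => evR t (b i)) →
      (∀ v : ι → ℝ, (∀ j ∉ S, v j = 0) → (A.map (evR t)).mulVec v = 0 → v = 0) →
      ∀ j, |x j| ≤ |(evalAt (P j) t : ℝ)| := by
  let D : Matrix ι ι (Polynomial ℤ) := Matrix.diagonal (fun j => if j ∈ S then 0 else 1)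
  let M : Matrix ι ι (Polynomial ℤ) := A.transpose * A + D
  refine ⟨M.adjugate.mulVec (A.transpose.mulVec b), fun t x hx hAx hind j => ?_⟩
  have hM : M.map (evR t) = (A.map (evR t)).transpose * (A.map (evR t)) +
      Matrix.diagonal (fun j => if j ∈ S then (0 : ℝ) else 1) := by
    simp only [M, D]
    rw [Matrix.map_add _ (map_add _), Matrix.map_mul, Matrix.transpose_map,
      Matrix.diagonal_map (map_zero _)]
    congr 2
    funext j
    change evR t (if j ∈ S then 0 else 1) = _
    split_ifs <;> simp
  have hdet : evR t M.det ≠ 0 := by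
    rw [RingHom.map_det, RingHom.mapMatrix_apply]
    intro h0
    obtain ⟨v, hv, hv0⟩ := Matrix.exists_mulVec_eq_zero_iff.2 h0
    apply hv
    have hq : v ⬝ᵥ ((M.map (evR t)).mulVec v) = 0 := by rw [hv0, dotProduct_zero]
    rw [hM, Matrix.add_mulVec, dotProduct_add, ← Matrix.mulVec_mulVec,
      Matrix.dotProduct_mulVec, Matrix.vecMul_transpose] at hq
    have hq1 : 0 ≤ (A.map (evR t)).mulVec v ⬝ᵥ (A.map (evR t)).mulVec v :=
      Finset.sum_nonneg fun i _ => mul_self_nonneg _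
    have hq2 : v ⬝ᵥ (Matrix.diagonal (fun j => if j ∈ S then (0 : ℝ) else 1)).mulVec v =
        ∑ j, (if j ∈ S then 0 else v j * v j) := by
      simp only [dotProduct, Matrix.mulVec_diagonal]
      refine Finset.sum_congr rfl fun j _ => ?_
      split_ifs <;> simp
    have hq3 : 0 ≤ ∑ j, (if j ∈ S then 0 else v j * v j) :=
      Finset.sum_nonneg fun j _ => by split_ifs; exacts [le_rfl, mul_self_nonneg _]
    rw [hq2] at hq
    refine hind v (fun j hj => ?_) ?_
    · have h3 : ∑ j, (if j ∈ S then 0 else v j * v j) = 0 := by linarith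
      have := (Finset.sum_eq_zero_iff_of_nonneg (fun j _ => by
        split_ifs; exacts [le_rfl, mul_self_nonneg _])).1 h3 j (Finset.mem_univ j)
      rw [if_neg hj] at this
      exact mul_self_eq_zero.1 this
    · have h4 : (A.map (evR t)).mulVec v ⬝ᵥ (A.map (evR t)).mulVec v = 0 := by linarith
      exact dotProduct_self_eq_zero.1 h4
  have hMx : (M.map (evR t)).mulVec x =
      (A.map (evR t)).transpose.mulVec (fun i => evR t (b i)) := by
    rw [hM, Matrix.add_mulVec, ← Matrix.mulVec_mulVec, hAx]
    convert add_zero _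
    funext j
    rw [Matrix.mulVec_diagonal]
    by_cases hj : j ∈ S
    · simp [hj]
    · simp [hx j hj]
  have hfin : evR t M.det * x j = (evalAt ((M.adjugate.mulVec (A.transpose.mulVec b)) j) t : ℝ) := by
    have h1 : (M.map (evR t)).adjugate.mulVec ((M.map (evR t)).mulVec x) =
        (evR t M.det) • x := by
      rw [Matrix.mulVec_mulVec, Matrix.adjugate_mul, Matrix.smul_mulVec, Matrix.one_mulVec,
        RingHom.map_det, RingHom.mapMatrix_apply]
    rw [hMx] at h1
    have h2 := congrFun h1 j
    simp only [Pi.smul_apply, smul_eq_mul] at h2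
    rw [← h2, ← evR_apply]
    rw [RingHom.map_mulVec, Function.comp_def]
    simp only [RingHom.map_mulVec]
    rw [← RingHom.mapMatrix_apply, ← RingHom.map_adjugate]
    rfl
  rw [← hfin, abs_mul]
  have : (1 : ℝ) ≤ |evR t M.det| := by
    rw [evR_apply] at hdet ⊢
    have : evalAt M.det t ≠ 0 := by exact_mod_cast hdet
    exact_mod_cast Int.one_le_abs this
  nlinarith [abs_nonneg (x j)]

theorem poly_bound {p ι : Type} [Fintype p] [Fintype ι]
    (A : Matrix p ι (Polynomial ℤ)) (b : p → Polynomial ℤ)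
    (hbdd : ∀ t : ℕ, 0 < t → Bornology.IsBounded
      {x : ι → ℝ | (∀ j, 0 ≤ x j) ∧
        ∀ i, ∑ j, (evalAt (A i j) t : ℝ) * x j = (evalAt (b i) t : ℝ)}) :
    ∃ r₀ N : ℕ, ∀ r ≥ r₀, ∀ t : ℕ, N ≤ t → ∀ x : ι → ℝ, (∀ j, 0 ≤ x j) →
      (∀ i, ∑ j, (evalAt (A i j) t : ℝ) * x j = (evalAt (b i) t : ℝ)) →
      ∀ j, x j < (t : ℝ) ^ r := by
  classical
  choose P hP using fun S : Finset ι => basic_bound A b S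
  obtain ⟨r, N, h⟩ := finite_poly_le_pow (fun k : Finset ι × ι => P k.1 k.2)
  refine ⟨r + 1, N + Fintype.card ι + 2, fun r' hr' t ht x hx hxA j => ?_⟩
  have hset : {x : ι → ℝ | (∀ j, 0 ≤ x j) ∧
        ∀ i, ∑ j, (evalAt (A i j) t : ℝ) * x j = (evalAt (b i) t : ℝ)} =
      {x : ι → ℝ | (∀ j, 0 ≤ x j) ∧ (A.map (evR t)).mulVec x = fun i => evR t (b i)} := by
    ext y
    simp only [Set.mem_ofPred_eq, funext_iff]
    rfl
  have hb := hbdd t (by omega)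
  rw [hset] at hb
  obtain ⟨y, hy0, hyA, hsum, hyind⟩ := exists_basic (A.map (evR t)) (fun i => evR t (b i)) hb x hx
    (funext hxA)
  have hle : ∀ j, y j ≤ (t : ℝ) ^ r := by
    intro j
    have h1 := hP (Finset.univ.filter (fun j => y j ≠ 0)) t y (fun j hj => by simpa using hj) hyA
      (fun v hv hv' => hyind v (fun j hj => hv j (by simpa using hj)) hv') j
    have h2 := h t (by omega) (Finset.univ.filter (fun j => y j ≠ 0), j)
    have h3 : |(evalAt (P (Finset.univ.filter (fun j => y j ≠ 0)) j) t : ℝ)| ≤ (t : ℝ) ^ r := by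
      exact_mod_cast h2
    exact (le_abs_self _).trans (h1.trans h3)
  have ht1 : (1 : ℝ) ≤ t := by exact_mod_cast (by omega : 1 ≤ t)
  calc x j ≤ ∑ j, x j := Finset.single_le_sum (fun i _ => hx i) (Finset.mem_univ j)
    _ ≤ ∑ j, y j := hsum
    _ ≤ ∑ _j : ι, (t : ℝ) ^ r := Finset.sum_le_sum fun j _ => hle j
    _ = (Fintype.card ι : ℝ) * (t : ℝ) ^ r := by simp
    _ < t * (t : ℝ) ^ r := by
        apply mul_lt_mul_of_pos_right _ (by positivity)
        exact_mod_cast (by omega : Fintype.card ι < t)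
    _ = (t : ℝ) ^ (r + 1) := by ring
    _ ≤ _ := pow_le_pow_right₀ ht1 hr'

theorem poly_bound_le {p ι : Type} [Fintype p] [Fintype ι]
    (A : Matrix p ι (Polynomial ℤ)) (b : p → Polynomial ℤ)
    (hbdd : ∀ t : ℕ, 0 < t → Bornology.IsBounded
      {x : ι → ℝ | (∀ j, 0 ≤ x j) ∧
        ∀ i, ∑ j, (evalAt (A i j) t : ℝ) * x j ≤ (evalAt (b i) t : ℝ)}) :
    ∃ r₀ N : ℕ, ∀ r ≥ r₀, ∀ t : ℕ, N ≤ t → ∀ x : ι → ℝ, (∀ j, 0 ≤ x j) →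
      (∀ i, ∑ j, (evalAt (A i j) t : ℝ) * x j ≤ (evalAt (b i) t : ℝ)) →
      ∀ j, x j < (t : ℝ) ^ r := by
  classical
  let A' : Matrix p (ι ⊕ p) (Polynomial ℤ) := Matrix.fromCols A 1
  have hexp : ∀ (t : ℕ) (x : ι ⊕ p → ℝ) (i : p), ∑ j, (evalAt (A' i j) t : ℝ) * x j =
      ∑ j, (evalAt (A i j) t : ℝ) * x (Sum.inl j) + x (Sum.inr i) := by
    intro t x i
    rw [Fintype.sum_sum_type]
    congr 1
    rw [Finset.sum_eq_single i]
    · simp [A', evalAt]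
    · intro j _ hj
      simp [A', evalAt, Matrix.one_apply_ne hj.symm]
    · simp
  have hbdd' : ∀ t : ℕ, 0 < t → Bornology.IsBounded
      {x : ι ⊕ p → ℝ | (∀ j, 0 ≤ x j) ∧
        ∀ i, ∑ j, (evalAt (A' i j) t : ℝ) * x j = (evalAt (b i) t : ℝ)} := by
    intro t ht
    let F : (ι → ℝ) → (ι ⊕ p → ℝ) := fun x =>
      Sum.elim x (fun i => (evalAt (b i) t : ℝ) - ∑ j, (evalAt (A i j) t : ℝ) * x j)
    have hF : Continuous F := by
      refine continuous_pi fun k => ?_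
      rcases k with k | k
      · exact continuous_apply k
      · simp only [F, Sum.elim_inr]; fun_prop
    refine (((hbdd t ht).isCompact_closure.image hF).isBounded).subset ?_
    rintro x ⟨hx0, hx⟩
    refine ⟨fun j => x (Sum.inl j), subset_closure ⟨fun j => hx0 _, fun i => ?_⟩, ?_⟩
    · have := hx i
      rw [hexp] at this
      linarith [hx0 (Sum.inr i)]
    · funext k
      rcases k with k | k
      · rfl
      · have := hx k
        rw [hexp] at this
        simp only [F, Sum.elim_inr]
        linarith
  obtain ⟨r₀, N, h⟩ := poly_bound A' b hbdd'
  refine ⟨r₀, N, fun r hr t ht x hx hxA j => ?_⟩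
  refine h r hr t ht (Sum.elim x (fun i => (evalAt (b i) t : ℝ) - ∑ j, (evalAt (A i j) t : ℝ) * x j))
    ?_ ?_ (Sum.inl j)
  · rintro (k | k)
    · exact hx k
    · simp only [Sum.elim_inr]; linarith [hxA k]
  · intro i
    rw [hexp]
    simp

end Bound

section Digits
variable {β ι : Type}

/-- The integer vector with base `t` digits `u`. -/
def dval {r : ℕ} (t : ℕ) (u : ι × Fin r → ℕ) (j : ι) : ℤ := ∑ i : Fin r, (t : ℤ) ^ (i : ℕ) * (u (j, i) : ℤ)

theorem dval_nonneg {r : ℕ} (t : ℕ) (u : ι × Fin r → ℕ) (j : ι) : 0 ≤ dval t u j :=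
  Finset.sum_nonneg fun i _ => by positivity

theorem dval_inj {r t : ℕ} {u w : ι × Fin r → ℕ} (hu : Dig t u) (hw : Dig t w)
    (h : dval t u = dval t w) : u = w := by
  funext ⟨j, i⟩
  have h1 := congrFun h j
  have h2 : (finFunctionFinEquiv (fun i => (⟨u (j, i), hu.2 _⟩ : Fin t)) : Fin (t ^ r)) =
      finFunctionFinEquiv (fun i => (⟨w (j, i), hw.2 _⟩ : Fin t)) := by
    apply Fin.ext
    rw [finFunctionFinEquiv_apply, finFunctionFinEquiv_apply]
    unfold dval at h1
    have h3 : ∑ i : Fin r, t ^ (i : ℕ) * u (j, i) = ∑ i : Fin r, t ^ (i : ℕ) * w (j, i) := by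
      exact_mod_cast h1
    simpa [mul_comm] using h3
  have h4 := congrFun (finFunctionFinEquiv.injective h2) i
  exact congrArg Fin.val h4

theorem dval_surj {r t : ℕ} (ht : 1 ≤ t) {x : ι → ℤ} (hx : ∀ j, 0 ≤ x j ∧ x j < (t : ℤ) ^ r) :
    ∃ u : ι × Fin r → ℕ, Dig t u ∧ dval t u = x := by
  have hlt : ∀ j, (x j).toNat < t ^ r := by
    intro j
    have := (hx j).2
    have h0 := (hx j).1
    zify
    rw [Int.toNat_of_nonneg h0]
    exact this
  refine ⟨fun k => (finFunctionFinEquiv.symm (⟨(x k.1).toNat, hlt k.1⟩ : Fin (t ^ r)) k.2 : Fin t),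
    ⟨ht, fun k => Fin.is_lt _⟩, ?_⟩
  funext j
  have h1 := finFunctionFinEquiv_apply
    (finFunctionFinEquiv.symm (⟨(x j).toNat, hlt j⟩ : Fin (t ^ r)))
  rw [Equiv.apply_symm_apply] at h1
  have h2 : x j = ((x j).toNat : ℤ) := (Int.toNat_of_nonneg (hx j).1).symm
  rw [h2]
  simp only at h1
  rw [h1]
  unfold dval
  push_cast
  exact Finset.sum_congr rfl fun i _ => mul_comm _ _

theorem ncard_dval {r t : ℕ} (ht : 1 ≤ t) {S : Set (ι → ℤ)}
    (hS : ∀ x ∈ S, ∀ j, 0 ≤ x j ∧ x j < (t : ℤ) ^ r) :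
    {u : ι × Fin r → ℕ | Dig t u ∧ dval t u ∈ S}.ncard = S.ncard := by
  have : S = dval t '' {u : ι × Fin r → ℕ | Dig t u ∧ dval t u ∈ S} := by
    ext x
    constructor
    · intro hx
      obtain ⟨u, hu, rfl⟩ := dval_surj ht (hS x hx)
      exact ⟨u, ⟨hu, hx⟩, rfl⟩
    · rintro ⟨u, ⟨_, hu⟩, rfl⟩
      exact hu
  conv_rhs => rw [this]
  rw [Set.ncard_image_of_injOn]
  intro u hu w hw h
  exact dval_inj hu.1 hw.1 h

theorem dig_finite [Finite β] (t : ℕ) : {u : β → ℕ | Dig t u}.Finite := by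
  refine (Set.Finite.pi' (fun _ : β => Set.finite_Iio t)).subset ?_
  intro u hu i
  exact hu.2 i

theorem PA.dval [Fintype β] {r : ℕ} (f : ι × Fin r → β) (j : ι) :
    PA (fun t (u : β → ℕ) => dval t (fun k => u (f k)) j) :=
  PA.sum _ fun i => (PA.aff _ (Aff.var (f (j, i)))).mulT _

theorem box_finite [Finite ι] (M : ℤ) {S : Set (ι → ℤ)} (hS : ∀ x ∈ S, ∀ j, 0 ≤ x j ∧ x j < M) :
    S.Finite := by
  refine (Set.Finite.pi' (fun _ : ι => Set.finite_Ico (0 : ℤ) M)).subset ?_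
  intro x hx i
  exact hS x hx i

end Digits

section Kth

theorem kth_unique {α : Type*} {S : Set α} (hS : S.Finite) {obj : α → ℤ} {ℓ : ℕ} {v : WithBot ℤ}
    (h : IsKthLargest S obj ℓ v) {z : ℤ} (h1 : {x ∈ S | z < obj x}.ncard < ℓ)
    (h2 : ℓ ≤ {x ∈ S | z ≤ obj x}.ncard) : v = z := by
  have mono : ∀ a b : ℤ, a < b → {x ∈ S | b ≤ obj x}.ncard ≤ {x ∈ S | a < obj x}.ncard :=
    fun a b hab => Set.ncard_le_ncard (fun x hx => ⟨hx.1, lt_of_lt_of_le hab hx.2⟩)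
      (hS.subset fun x hx => hx.1)
  rcases h with ⟨h, _⟩ | ⟨_, z', rfl, h3, h4⟩
  · have := Set.ncard_le_ncard (s := {x ∈ S | z ≤ obj x}) (t := S) (fun x hx => hx.1) hS
    omega
  · congr 1
    rcases lt_trichotomy z z' with h | h | h
    · have := mono _ _ h; omega
    · exact h.symm
    · have := mono _ _ h; omega

theorem kth_attained {α : Type*} {S : Set α} (hS : S.Finite) {obj : α → ℤ} {ℓ : ℕ} {z : ℤ}
    (h1 : {x ∈ S | z < obj x}.ncard < ℓ)
    (h2 : ℓ ≤ {x ∈ S | z ≤ obj x}.ncard) : ∃ x ∈ S, obj x = z := by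
  by_contra hcon
  push Not at hcon
  have := Set.ncard_le_ncard (s := {x ∈ S | z ≤ obj x}) (t := {x ∈ S | z < obj x})
    (fun x hx => ⟨hx.1, lt_of_le_of_ne hx.2 (hcon x hx.1).symm⟩) (hS.subset fun x hx => hx.1)
  omega

end Kth

/-- Main Theorem, optimum value functions: for the parametric exclusion
problem, the `ℓ`-th largest value of the objective `c(t)·x₂` over `L₃(t)` is
eventually quasi-polynomial. -/
theorem exclusion_kth_largest_eqp (m n1 n2 p1 p2 : ℕ)
    (hm : 0 < m) (hn1 : 0 < n1) (hn2 : 0 < n2) (hp1 : 0 < p1) (hp2 : 0 < p2)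
    (c : Fin n2 → Polynomial ℤ)
    (A1 : Matrix (Fin p1) (Fin n2 ⊕ Fin n1) (Polynomial ℤ)) (b1 : Fin p1 → Polynomial ℤ)
    (A2 : Matrix (Fin p2) (Fin n2) (Polynomial ℤ)) (b2 : Fin p2 → Polynomial ℤ)
    (hbdd1 : ∀ t : ℕ, 0 < t → Bornology.IsBounded
      {x : (Fin n2 ⊕ Fin n1) → ℝ | (∀ j, 0 ≤ x j) ∧
        ∀ i, ∑ j, (evalAt (A1 i j) t : ℝ) * x j = (evalAt (b1 i) t : ℝ)})
    (hbdd2 : ∀ t : ℕ, 0 < t → Bornology.IsBounded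
      {x : Fin n2 → ℝ | (∀ j, 0 ≤ x j) ∧
        ∀ i, ∑ j, (evalAt (A2 i j) t : ℝ) * x j ≤ (evalAt (b2 i) t : ℝ)})
    (ℓ : ℕ) (hl : 0 < ℓ) (f : ℕ → WithBot ℤ)
    (hf : ∀ t : ℕ, 0 < t → IsKthLargest (latticeL3 m A1 b1 A2 b2 t)
      (fun x2 => ∑ j, evalAt (c j) t * x2 j) ℓ (f t)) :
    IsEQPBot f := by
  classical
  obtain ⟨r1, N1, hB1⟩ := poly_bound A1 b1 hbdd1
  obtain ⟨r2, N2, hB2⟩ := poly_bound_le A2 b2 hbdd2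
  -- common number of digits
  obtain ⟨r, hr⟩ : ∃ r, r = max r1 r2 := ⟨_, rfl⟩
  have hbox1 : ∀ t, N1 ≤ t → ∀ x ∈ latticeL1 A1 b1 t, ∀ j, 0 ≤ x j ∧ x j < (t : ℤ) ^ r := by
    rintro t ht x ⟨hx0, hx⟩ j
    refine ⟨hx0 j, ?_⟩
    have := hB1 r (by omega) t ht (fun j => (x j : ℝ)) (fun j => by exact_mod_cast hx0 j)
      (fun i => by exact_mod_cast hx i) j
    exact_mod_cast this
  have hbox2 : ∀ t, N2 ≤ t → ∀ x ∈ latticeL2 A2 b2 t, ∀ j, 0 ≤ x j ∧ x j < (t : ℤ) ^ r := by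
    rintro t ht x ⟨hx0, hx⟩ j
    refine ⟨hx0 j, ?_⟩
    have := hB2 r (by omega) t ht (fun j => (x j : ℝ)) (fun j => by exact_mod_cast hx0 j)
      (fun i => by exact_mod_cast hx i) j
    exact_mod_cast this
  -- the relation `(x₂, x₃) ∈ L₁(t)` in digits
  let R1 : ℕ → ((Fin n2 × Fin r) ⊕ (Fin n1 × Fin r) → ℕ) → Prop := fun t u =>
    Dig t u ∧ ∀ i, (Dig t u ∧ ∑ j, evalAt (A1 i j) t *
      (Sum.elim (dval t fun k => u (Sum.inl k)) (dval t fun k => u (Sum.inr k)) j : ℤ) =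
        evalAt (b1 i) t)
  have hR1 : Pres R1 := by
    refine pres_dig.and (Pres.all fun i => PA.eq (PA.sum _ fun j => ?_) (PA.poly _))
    rcases j with j | j
    · exact (PA.dval Sum.inl j).mulPoly _
    · exact (PA.dval Sum.inr j).mulPoly _
  have hR1fin : ∀ t u, {w | R1 t (Sum.elim u w)}.Finite := by
    intro t u
    refine (dig_finite t).subset ?_
    intro w hw
    exact ⟨hw.1.1, fun i => hw.1.2 (Sum.inr i)⟩
  -- the relation `x₂ ∈ L₃(t)` in digits
  let R3 : ℕ → (Fin n2 × Fin r → ℕ) → Prop := fun t u =>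
    (Dig t u ∧ ∀ i, (Dig t u ∧ ∑ j, evalAt (A2 i j) t * dval t (fun k => u k) j ≤
      evalAt (b2 i) t)) ∧ ¬ (m ≤ {w | R1 t (Sum.elim u w)}.ncard)
  have hR3 : Pres R3 := by
    refine Pres.and (pres_dig.and (Pres.all fun i => PA.le (PA.sum _ fun j => ?_) (PA.poly _)))
      (hR1.card_ge hR1fin m).not
    exact (PA.dval (fun k => k) j).mulPoly _
  have hR3iff : ∀ t, N1 + N2 + 1 ≤ t → ∀ u, R3 t u ↔
      Dig t u ∧ dval t u ∈ latticeL3 m A1 b1 A2 b2 t := by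
    intro t ht u
    by_cases hu : Dig t u
    swap
    · constructor
      · exact fun h => absurd h.1.1 hu
      · exact fun h => absurd h.1 hu
    have hc : {w | R1 t (Sum.elim u w)}.ncard =
        {x3 : Fin n1 → ℤ | Sum.elim (dval t u) x3 ∈ latticeL1 A1 b1 t}.ncard := by
      rw [← ncard_dval (r := r) (t := t) (by omega)]
      · congr 1
        ext w
        constructor
        · rintro ⟨hd, hw⟩
          refine ⟨⟨hd.1, fun i => hd.2 (Sum.inr i)⟩, ?_, fun i => (hw i).2⟩
          rintro (j | j)
          · exact dval_nonneg _ _ _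
          · exact dval_nonneg _ _ _
        · rintro ⟨hd, _, hw⟩
          have hd' : Dig t (Sum.elim u w) := by
            refine ⟨hd.1, ?_⟩
            rintro (j | j)
            · exact hu.2 j
            · exact hd.2 j
          exact ⟨hd', fun i => ⟨hd', hw i⟩⟩
      · intro x hx j
        exact hbox1 t (by omega) _ hx (Sum.inr j)
    constructor
    · rintro ⟨⟨_, h2⟩, h3⟩
      rw [hc] at h3
      exact ⟨hu, ⟨fun j => dval_nonneg _ _ _, fun i => (h2 i).2⟩, not_le.1 h3⟩
    · rintro ⟨_, ⟨_, h2⟩, h3⟩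
      refine ⟨⟨hu, fun i => ⟨hu, h2 i⟩⟩, ?_⟩
      rw [hc]
      exact not_le.2 h3
  -- comparison relations
  let obj : ℕ → (Fin n2 → ℤ) → ℤ := fun t x2 => ∑ j, evalAt (c j) t * x2 j
  let Rlt : ℕ → ((Fin n2 × Fin r) ⊕ (Fin n2 × Fin r) → ℕ) → Prop := fun t u =>
    R3 t (fun k => u (Sum.inr k)) ∧
      (Dig t u ∧ obj t (dval t fun k => u (Sum.inl k)) < obj t (dval t fun k => u (Sum.inr k)))
  let Rle : ℕ → ((Fin n2 × Fin r) ⊕ (Fin n2 × Fin r) → ℕ) → Prop := fun t u =>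
    R3 t (fun k => u (Sum.inr k)) ∧
      (Dig t u ∧ obj t (dval t fun k => u (Sum.inl k)) ≤ obj t (dval t fun k => u (Sum.inr k)))
  have hRlt : Pres Rlt := (hR3.comp Sum.inr).and
    (PA.lt (PA.sum _ fun j => (PA.dval Sum.inl j).mulPoly _)
      (PA.sum _ fun j => (PA.dval Sum.inr j).mulPoly _))
  have hRle : Pres Rle := (hR3.comp Sum.inr).and
    (PA.le (PA.sum _ fun j => (PA.dval Sum.inl j).mulPoly _)
      (PA.sum _ fun j => (PA.dval Sum.inr j).mulPoly _))
  have hRltfin : ∀ t u, {w | Rlt t (Sum.elim u w)}.Finite := by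
    intro t u
    refine (dig_finite t).subset ?_
    intro w hw
    exact hw.1.1.1
  have hRlefin : ∀ t u, {w | Rle t (Sum.elim u w)}.Finite := by
    intro t u
    refine (dig_finite t).subset ?_
    intro w hw
    exact hw.1.1.1
  let D : ℕ → (Fin n2 × Fin r → ℕ) → Prop := fun t u =>
    R3 t u ∧ (¬ (ℓ ≤ {w | Rlt t (Sum.elim u w)}.ncard) ∧ ℓ ≤ {w | Rle t (Sum.elim u w)}.ncard)
  have hD : Pres D := hR3.and ((hRlt.card_ge hRltfin ℓ).not.and (hRle.card_ge hRlefin ℓ))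
  have hS : ∀ t, N1 + N2 + 1 ≤ t → ∀ x ∈ latticeL3 m A1 b1 A2 b2 t, ∀ j,
      0 ≤ x j ∧ x j < (t : ℤ) ^ r := fun t ht x hx => hbox2 t (by omega) x hx.1
  have hcomb : ∀ t u w, Dig t u → Dig t w → Dig t (Sum.elim u w :
      (Fin n2 × Fin r) ⊕ (Fin n2 × Fin r) → ℕ) := by
    intro t u w hu hw
    refine ⟨hu.1, ?_⟩
    rintro (j | j)
    · exact hu.2 j
    · exact hw.2 j
  have hlt : ∀ t, N1 + N2 + 1 ≤ t → ∀ u, Dig t u → {w | Rlt t (Sum.elim u w)}.ncard =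
      {x ∈ latticeL3 m A1 b1 A2 b2 t | obj t (dval t u) < obj t x}.ncard := by
    intro t ht u hu
    rw [← ncard_dval (r := r) (t := t) (by omega) (fun x hx => hS t ht x hx.1)]
    congr 1
    ext w
    constructor
    · rintro ⟨h1, h2, h3⟩
      have := (hR3iff t ht _).1 h1
      exact ⟨this.1, this.2, h3⟩
    · rintro ⟨h1, h2, h3⟩
      exact ⟨(hR3iff t ht _).2 ⟨h1, h2⟩, hcomb t u w hu h1, h3⟩
  have hle : ∀ t, N1 + N2 + 1 ≤ t → ∀ u, Dig t u → {w | Rle t (Sum.elim u w)}.ncard =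
      {x ∈ latticeL3 m A1 b1 A2 b2 t | obj t (dval t u) ≤ obj t x}.ncard := by
    intro t ht u hu
    rw [← ncard_dval (r := r) (t := t) (by omega) (fun x hx => hS t ht x hx.1)]
    congr 1
    ext w
    constructor
    · rintro ⟨h1, h2, h3⟩
      have := (hR3iff t ht _).1 h1
      exact ⟨this.1, this.2, h3⟩
    · rintro ⟨h1, h2, h3⟩
      exact ⟨(hR3iff t ht _).2 ⟨h1, h2⟩, hcomb t u w hu h1, h3⟩
  have hDf : ∀ t, N1 + N2 + 1 ≤ t → ∀ u, D t u → f t = ((obj t (dval t u) : ℤ) : WithBot ℤ) := by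
    rintro t ht u ⟨h1, h2, h3⟩
    have hu := (hR3iff t ht u).1 h1
    rw [hlt t ht u hu.1] at h2
    rw [hle t ht u hu.1] at h3
    exact kth_unique (box_finite _ (hS t ht)) (hf t (by omega)) (not_le.1 h2) h3
  have hDbot : ∀ t, N1 + N2 + 1 ≤ t → (∀ u, ¬ D t u) → f t = ⊥ := by
    intro t ht hno
    rcases hf t (by omega) with ⟨_, h⟩ | ⟨_, z, _, h1, h2⟩
    · exact h
    · exfalso
      obtain ⟨x, hx, hxz⟩ := kth_attained (box_finite _ (hS t ht)) h1 h2
      obtain ⟨u, hu, rfl⟩ := dval_surj (r := r) (t := t) (by omega) (hS t ht x hx)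
      subst hxz
      refine hno u ⟨(hR3iff t ht u).2 ⟨hu, hx⟩, ?_, ?_⟩
      · rw [hlt t ht u hu]; exact not_le.2 h1
      · rw [hle t ht u hu]; exact h2
  obtain ⟨d, hd, hsel⟩ := sel_semilinear (FirstOrder.Language.presburger.definable_iff_isSemilinearSet.1 hD)
  refine ⟨d, hd, fun s hs => ?_⟩
  rcases hsel s hs with ⟨a, b, N, h⟩ | ⟨N, h⟩
  · left
    refine ⟨∑ j, (c j).map (Int.castRingHom ℚ) * ∑ i : Fin r, Polynomial.X ^ (i : ℕ) *
      (Polynomial.C (a (j, i)) + Polynomial.C (b (j, i)) * Polynomial.X), N + N1 + N2 + 1,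
      fun t ht hts => ?_⟩
    obtain ⟨v, hv, hvt, hvi⟩ := h t (by omega) hts
    have hv' : D (v none) (fun i => v (some i)) := hv
    rw [hvt] at hv'
    refine ⟨_, hDf t (by omega) _ hv', ?_⟩
    simp only [obj, dval]
    push_cast
    simp only [hvi, Polynomial.eval_finset_sum, Polynomial.eval_mul, Polynomial.eval_pow,
      Polynomial.eval_X, Polynomial.eval_add, Polynomial.eval_C]
    refine Finset.sum_congr rfl fun j _ => ?_
    congr 1
    rw [Polynomial.eval_natCast_map]
    simp [evalAt]
  · right
    refine ⟨N + N1 + N2 + 1, fun t ht hts => hDbot t (by omega) fun u hu => ?_⟩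
    exact h t (by omega) hts (fun o => o.elim t u) hu rfl
end
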